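/- arXiv:1606.00860 — 2 statements merged into one kernel-verified Lean document; each statement's English description precedes it below -/
import Mathlib

section
/- Assume the Riemann Hypothesis. Then, as N → ∞, Σ_{n=N+1}^{N+H} r'_{2,2}(n) = (π/4) H + O( H²/N + H (log log N)/(log N)^{1/2} ), uniformly for H in the range N^{1/2}(log N)² = o(H) and H = o(N). -/
open Finset Filter Asymptotics

/-- `r'_{2,2}(n) = ∑_{p² + m² = n} log p`, the sum running over primes `p` and positive
integers `m`, counting weighted representations of `n` as a prime square plus a square. -/
noncomputable def r22' (n : ℕ) : ℝ :=
  ∑ p ∈ Finset.range (n + 1), ∑ m ∈ Finset.Icc 1 n,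
    if p.Prime ∧ p ^ 2 + m ^ 2 = n then Real.log p else 0

section LogDeriv

/-- On a disc where `f` is holomorphic and zero-free with `‖f‖ ≤ B ‖f c‖`, the logarithmic
derivative is `O(log B)` on concentric smaller discs. -/
theorem norm_logDeriv_le_of_norm_le {f : ℂ → ℂ} {c : ℂ} {r r' R B : ℝ} (hB : 1 < B)
    (hr : 0 ≤ r) (hrr : r < r') (hrR : r' < R) (hf : DifferentiableOn ℂ f (Metric.ball c R))
    (h0 : ∀ z ∈ Metric.ball c R, f z ≠ 0) (hb : ∀ z ∈ Metric.ball c R, ‖f z‖ ≤ B * ‖f c‖)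
    {z : ℂ} (hz : ‖z - c‖ ≤ r) :
    ‖deriv f z / f z‖ ≤ 2 * r' / ((R - r') * (r' - r)) * Real.log B := by
  have hR : 0 < R := by linarith
  have hlog : 0 < Real.log B := Real.log_pos hB
  have hc : c ∈ Metric.ball c R := Metric.mem_ball_self hR
  have hdf : DifferentiableOn ℂ (fun w => deriv f w / f w) (Metric.ball c R) :=
    (hf.deriv Metric.isOpen_ball).div hf h0
  obtain ⟨L, hLc, hL⟩ := hdf.isExactOn_ball.with_val_at c 0
  have hexp : ∀ w ∈ Metric.ball c R, f w = f c * Complex.exp (L w) := by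
    have key : ∀ w ∈ Metric.ball c R, HasDerivAt (fun w => f w * Complex.exp (-L w)) 0 w := by
      intro w hw
      have h1 := (hf.differentiableAt (Metric.isOpen_ball.mem_nhds hw)).hasDerivAt
      have h2 := (hL w hw).neg.cexp
      have h3 := h1.mul h2
      have h4 := h0 w hw
      refine h3.congr_deriv ?_
      field_simp
      ring
    intro w hw
    have := (convex_ball c R).is_const_of_fderivWithin_eq_zero (𝕜 := ℂ)
      (f := fun w => f w * Complex.exp (-L w))
      (fun x hx => (key x hx).differentiableAt.differentiableWithinAt)
      (fun x hx => by
        rw [fderivWithin_of_isOpen Metric.isOpen_ball hx]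
        ext; simp [(key x hx).deriv]) hw hc
    simp only [hLc, neg_zero, Complex.exp_zero, mul_one] at this
    rw [← this, mul_assoc, ← Complex.exp_add]
    simp
  have hLd : DifferentiableOn ℂ L (Metric.ball c R) := fun w hw =>
    (hL w hw).differentiableAt.differentiableWithinAt
  have hre : ∀ w ∈ Metric.ball c R, (L w).re ≤ Real.log B := by
    intro w hw
    have h1 := hb w hw
    rw [hexp w hw, norm_mul, Complex.norm_exp, mul_comm B] at h1
    have h2 := le_of_mul_le_mul_left h1 (norm_pos_iff.mpr (h0 c hc))
    exact (Real.le_log_iff_exp_le (by linarith)).mpr h2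
  have hBC : ∀ w, ‖w - c‖ ≤ r' → ‖L w‖ ≤ 2 * Real.log B * r' / (R - r') := by
    intro w hw
    have hmaps : ∀ x ∈ Metric.ball (0 : ℂ) R, c + x ∈ Metric.ball c R := by
      intro x hx; simpa [dist_eq_norm] using hx
    have := Complex.borelCaratheodory_zero (f := fun x => L (c + x)) (z := w - c) hlog
      (hLd.comp (by fun_prop) hmaps) (fun x hx => hre _ (hmaps x hx)) hR
      (by simpa using lt_of_le_of_lt hw hrR) (by simpa using hLc)
    simp only [add_sub_cancel] at this
    refine this.trans ?_
    have : 0 < R - r' := by linarith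
    have : 0 ≤ r' := by linarith
    gcongr
  have hzb : z ∈ Metric.ball c R := by
    rw [Metric.mem_ball, dist_eq_norm]; linarith
  have hsub : Metric.closedBall z (r' - r) ⊆ Metric.closedBall c r' := by
    apply Metric.closedBall_subset_closedBall'
    rw [dist_eq_norm]; linarith
  have hd : DiffContOnCl ℂ L (Metric.ball z (r' - r)) := by
    apply DifferentiableOn.diffContOnCl
    rw [closure_ball _ (by linarith)]
    exact hLd.mono (hsub.trans (Metric.closedBall_subset_ball hrR))
  have := Complex.norm_deriv_le_of_forall_mem_sphere_norm_le (by linarith) hd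
    (C := 2 * Real.log B * r' / (R - r')) (fun w hw => hBC w (by
      have := hsub (Metric.sphere_subset_closedBall hw)
      rwa [Metric.mem_closedBall, dist_eq_norm] at this))
  rw [(hL z hzb).deriv] at this
  refine this.trans (le_of_eq ?_)
  have : R - r' ≠ 0 := by linarith
  have : r' - r ≠ 0 := by linarith
  field_simp

end LogDeriv

section ZetaGrowth

/-- The fractional part, cut off to `(1, ∞)`. -/
noncomputable def fractTail (t : ℝ) : ℂ := if 1 < t then ((Int.fract t : ℝ) : ℂ) else 0

theorem norm_fractTail_le (t : ℝ) : ‖fractTail t‖ ≤ 1 := by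
  unfold fractTail
  split_ifs
  · rw [Complex.norm_real, Real.norm_of_nonneg (Int.fract_nonneg t)]
    exact (Int.fract_lt_one t).le
  · simp

theorem measurable_fractTail : Measurable fractTail := by
  unfold fractTail
  exact Measurable.ite measurableSet_Ioi (Complex.measurable_ofReal.comp measurable_fract)
    measurable_const

theorem mellin_fractTail_eq (s : ℂ) :
    mellin fractTail (-s) = ∫ t in Set.Ioi (1 : ℝ), (t : ℂ) ^ (-(s + 1)) * ((Int.fract t : ℝ) : ℂ) := by
  rw [mellin, ← MeasureTheory.integral_indicator measurableSet_Ioi,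
    ← MeasureTheory.integral_indicator measurableSet_Ioi]
  congr 1
  ext t
  by_cases h1 : 1 < t
  · have h0 : 0 < t := by linarith
    simp [Set.indicator, fractTail, h1, h0, neg_sub_left, add_comm]
  · simp [Set.indicator, fractTail, h1]

theorem differentiableAt_mellin_fractTail {s : ℂ} (hs : 0 < s.re) :
    DifferentiableAt ℂ (fun s => mellin fractTail (-s)) s := by
  have : DifferentiableAt ℂ (mellin fractTail) (-s) := by
    refine mellin_differentiableAt_of_isBigO_rpow (a := 0) (b := -s.re - 1) ?_ ?_ ?_ ?_ ?_
    · apply MeasureTheory.LocallyIntegrable.locallyIntegrableOn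
      refine (MeasureTheory.locallyIntegrable_const (1 : ℝ)).mono
        measurable_fractTail.aestronglyMeasurable (MeasureTheory.ae_of_all _ fun t => ?_)
      simpa using norm_fractTail_le t
    · apply Asymptotics.IsBigO.of_bound 1
      refine Eventually.of_forall fun t => ?_
      simpa using norm_fractTail_le t
    · simpa using hs
    · apply Asymptotics.IsBigO.of_bound 1
      filter_upwards [nhdsWithin_le_nhds (eventually_lt_nhds (zero_lt_one (α := ℝ)))] with t ht
      simp only [fractTail, not_lt.mpr ht.le, if_false, norm_zero]
      positivity
    · simp
  exact this.comp s differentiableAt_id.neg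

theorem norm_mellin_fractTail_le {s : ℂ} (hs : 0 < s.re) :
    ‖mellin fractTail (-s)‖ ≤ 1 / s.re := by
  rw [mellin_fractTail_eq]
  have h1 : ∫ t in Set.Ioi (1 : ℝ), t ^ (-(s.re + 1)) = 1 / s.re := by
    rw [integral_Ioi_rpow_of_lt (by linarith) one_pos]
    simp
  rw [← h1]
  refine MeasureTheory.norm_integral_le_of_norm_le
    (integrableOn_Ioi_rpow_of_lt (by linarith) one_pos) ?_
  refine (MeasureTheory.ae_restrict_mem measurableSet_Ioi).mono fun t ht => ?_
  have h0 : 0 < t := lt_trans one_pos ht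
  rw [norm_mul, Complex.norm_cpow_eq_rpow_re_of_pos h0, Complex.norm_real,
    Real.norm_of_nonneg (Int.fract_nonneg t)]
  simp only [Complex.neg_re, Complex.add_re, Complex.one_re]
  exact mul_le_of_le_one_right (by positivity) (Int.fract_lt_one t).le

theorem integrableOn_cpow_mul_fract {s : ℂ} (hs : 0 < s.re) :
    MeasureTheory.IntegrableOn (fun t : ℝ => (t : ℂ) ^ (-(s + 1)) * ((Int.fract t : ℝ) : ℂ))
      (Set.Ioi 1) := by
  refine MeasureTheory.Integrable.mono'
    (integrableOn_Ioi_rpow_of_lt (show -(s.re + 1) < -1 by linarith) one_pos) ?_ ?_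
  · apply MeasureTheory.AEStronglyMeasurable.mul
    · apply ContinuousOn.aestronglyMeasurable _ measurableSet_Ioi
      intro t ht
      exact (Complex.continuousAt_ofReal_cpow_const t _
        (Or.inr (lt_trans one_pos ht).ne')).continuousWithinAt
    · exact (Complex.measurable_ofReal.comp measurable_fract).aestronglyMeasurable
  · refine (MeasureTheory.ae_restrict_mem measurableSet_Ioi).mono fun t ht => ?_
    have h0 : 0 < t := lt_trans one_pos ht
    rw [norm_mul, Complex.norm_cpow_eq_rpow_re_of_pos h0, Complex.norm_real,
      Real.norm_of_nonneg (Int.fract_nonneg t)]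
    simp only [Complex.neg_re, Complex.add_re, Complex.one_re]
    exact mul_le_of_le_one_right (by positivity) (Int.fract_lt_one t).le

theorem riemannZeta_eq_sub_mellin_fractTail {s : ℂ} (hs : 1 < s.re) :
    riemannZeta s = s / (s - 1) - s * mellin fractTail (-s) := by
  have hs1 : s - 1 ≠ 0 := by
    intro h
    rw [sub_eq_zero.mp h] at hs
    simp at hs
  have hO : (fun n : ℕ => ∑ k ∈ Icc 1 n, ‖(1 : ℕ → ℂ) k‖) =O[atTop]
      fun n : ℕ => (n : ℝ) ^ (1 : ℝ) := by
    simp only [Pi.one_apply, norm_one, sum_const, Nat.card_Icc, Real.rpow_one]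
    simpa using isBigO_refl _ _
  rw [← LSeries_one_eq_riemannZeta hs, LSeries_eq_mul_integral' 1 zero_le_one hs hO,
    mellin_fractTail_eq]
  have h1 : ∀ t ∈ Set.Ioi (1 : ℝ), (∑ k ∈ Icc 1 ⌊t⌋₊, (1 : ℕ → ℂ) k) * (t : ℂ) ^ (-(s + 1)) =
      (t : ℂ) ^ (-s) - (t : ℂ) ^ (-(s + 1)) * ((Int.fract t : ℝ) : ℂ) := by
    intro t ht
    have h0 : 0 < t := lt_trans one_pos ht
    have h0' : (t : ℂ) ≠ 0 := by exact_mod_cast h0.ne'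
    have h2 : ((Int.fract t : ℝ) : ℂ) = t - ⌊t⌋₊ := by
      have : (⌊t⌋ : ℝ) = (⌊t⌋₊ : ℝ) := by
        rw [← natCast_floor_eq_intCast_floor h0.le]
      rw [← Int.self_sub_floor, this]
      push_cast; rfl
    have h3 : (t : ℂ) ^ (-s) = (t : ℂ) ^ (-(s + 1)) * t := by
      rw [neg_add, ← sub_eq_add_neg, Complex.cpow_sub _ _ h0', Complex.cpow_one]
      field_simp
    rw [h2, h3]
    simp
    ring
  rw [MeasureTheory.setIntegral_congr_fun measurableSet_Ioi h1,
    MeasureTheory.integral_sub (integrableOn_Ioi_cpow_of_lt (by simpa using hs) one_pos)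
      (integrableOn_cpow_mul_fract (by linarith)),
    integral_Ioi_cpow_of_lt (by simpa using hs) one_pos]
  have h4 : -s + 1 ≠ 0 := by
    intro h; apply hs1; linear_combination -h
  simp only [Complex.ofReal_one, Complex.one_cpow]
  rw [mul_sub]
  congr 1
  field_simp
  ring

theorem riemannZeta₁_eq {s : ℂ} (hs : 0 < s.re) :
    riemannZeta₁ s = s - (s - 1) * s * mellin fractTail (-s) := by
  have hopen : IsOpen {s : ℂ | 0 < s.re} := isOpen_lt continuous_const Complex.continuous_re
  have h1 : AnalyticOnNhd ℂ riemannZeta₁ {s : ℂ | 0 < s.re} :=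
    differentiable_riemannZeta₁.differentiableOn.analyticOnNhd hopen
  have h2 : AnalyticOnNhd ℂ (fun s => s - (s - 1) * s * mellin fractTail (-s))
      {s : ℂ | 0 < s.re} := by
    apply DifferentiableOn.analyticOnNhd _ hopen
    intro w hw
    have := differentiableAt_mellin_fractTail hw
    exact DifferentiableAt.differentiableWithinAt (by fun_prop)
  have hpre : IsPreconnected {s : ℂ | 0 < s.re} :=
    (convex_halfSpace_re_gt 0).isPreconnected
  refine h1.eqOn_of_preconnected_of_eventuallyEq h2 hpre (z₀ := 2) (by simp) ?_ hs
  have : {s : ℂ | 1 < s.re} ∈ nhds (2 : ℂ) :=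
    (isOpen_lt continuous_const Complex.continuous_re).mem_nhds (by simp)
  filter_upwards [this] with w hw
  have hw1 : w ≠ 1 := by rintro rfl; simp at hw
  have hw2 : w - 1 ≠ 0 := sub_ne_zero.mpr hw1
  have h := riemannZeta_eq_sub_mellin_fractTail hw
  rw [riemannZeta_eq_inv_sub_mul hw1] at h
  field_simp at h
  linear_combination h

theorem norm_riemannZeta₁_le {s : ℂ} (hs : 1 / 2 < s.re) :
    ‖riemannZeta₁ s‖ ≤ ‖s‖ + 2 * ((‖s‖ + 1) * ‖s‖) := by
  rw [riemannZeta₁_eq (by linarith)]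
  have h1 := norm_mellin_fractTail_le (s := s) (by linarith)
  have h2 : 1 / s.re ≤ 2 := by
    rw [div_le_iff₀ (by linarith)]; linarith
  have h3 : ‖s - 1‖ ≤ ‖s‖ + 1 := by simpa using norm_sub_le s 1
  calc _ ≤ ‖s‖ + ‖(s - 1) * s * mellin fractTail (-s)‖ := norm_sub_le _ _
    _ = ‖s‖ + ‖s - 1‖ * ‖s‖ * ‖mellin fractTail (-s)‖ := by simp
    _ ≤ ‖s‖ + (‖s‖ + 1) * ‖s‖ * 2 := by gcongr; linarith
    _ = _ := by ring

theorem exists_lower_bound_riemannZeta_re_two :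
    ∃ K : ℝ, 0 < K ∧ ∀ s : ℂ, s.re = 2 → 1 ≤ K * ‖riemannZeta s‖ := by
  refine ⟨(∑' n, ‖LSeries.term (fun n => ((ArithmeticFunction.moebius n : ℤ) : ℂ)) 2 n‖) + 1,
    by positivity, fun s hs => ?_⟩
  have hs1 : 1 < s.re := by linarith
  have h1 := LSeries_one_mul_Lseries_moebius hs1
  rw [LSeries_one_eq_riemannZeta hs1] at h1
  have h2 := congrArg norm h1
  rw [norm_mul, norm_one] at h2
  have h3 : ∀ n, ‖LSeries.term (fun n => ((ArithmeticFunction.moebius n : ℤ) : ℂ)) s n‖ =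
      ‖LSeries.term (fun n => ((ArithmeticFunction.moebius n : ℤ) : ℂ)) 2 n‖ := by
    intro n; simp [LSeries.norm_term_eq, hs]
  have h4 : Summable fun n =>
      ‖LSeries.term (fun n => ((ArithmeticFunction.moebius n : ℤ) : ℂ)) s n‖ :=
    (ArithmeticFunction.LSeriesSummable_moebius_iff.mpr hs1).norm
  have := norm_tsum_le_tsum_norm h4
  simp only [h3] at this
  calc (1 : ℝ) = _ := h2.symm
    _ = _ := mul_comm _ _
    _ ≤ _ := by
      gcongr
      exact this.trans (by linarith)

/-- Under RH the function `(s - 1) ζ(s)` has no zeros to the right of the critical line. -/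
theorem RiemannHypothesis.riemannZeta₁_ne_zero (hRH : RiemannHypothesis) {s : ℂ}
    (hs : 1 / 2 < s.re) : riemannZeta₁ s ≠ 0 := by
  rcases eq_or_ne s 1 with rfl | h1
  · simp
  intro h
  have hz : riemannZeta s = 0 := by rw [riemannZeta_eq_inv_sub_mul h1, h, mul_zero]
  have := hRH s hz (by
    rintro ⟨n, rfl⟩
    have : ((-2 * ((n : ℂ) + 1))).re = -2 * ((n : ℝ) + 1) := by simp
    rw [this] at hs
    have : (0 : ℝ) ≤ n := n.cast_nonneg
    linarith) h1
  linarith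

/-- Under RH the logarithmic derivative of `(s - 1) ζ(s)` grows at most like `√(1 + |t|)` in the
strip `3/4 ≤ σ ≤ 2`. -/
theorem RiemannHypothesis.exists_norm_logDeriv_riemannZeta₁_le (hRH : RiemannHypothesis) :
    ∃ C : ℝ, 0 < C ∧ ∀ s : ℂ, 3 / 4 ≤ s.re → s.re ≤ 2 →
      ‖deriv riemannZeta₁ s / riemannZeta₁ s‖ ≤ C * (1 + |s.im|) ^ (1 / 2 : ℝ) := by
  obtain ⟨K, hK, hlow⟩ := exists_lower_bound_riemannZeta_re_two
  refine ⟨176 * (4 * (44 * (K + 1)) ^ (1 / 4 : ℝ)), by positivity, fun s hs1 hs2 => ?_⟩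
  set t := s.im
  set c : ℂ := ⟨2, t⟩ with hcdef
  have hc1 : c ≠ 1 := by
    intro h; have := congrArg Complex.re h; norm_num [hcdef] at this
  have hfc : 1 ≤ K * ‖riemannZeta₁ c‖ := by
    have h1 := hlow c rfl
    rw [riemannZeta_eq_inv_sub_mul hc1, norm_mul, norm_inv] at h1
    have h2 : 1 ≤ ‖c - 1‖ := by
      have := Complex.abs_re_le_norm (c - 1)
      have h3 : (c - 1).re = 1 := by norm_num [hcdef]
      rw [h3] at this; simpa using this
    have h3 : ‖c - 1‖⁻¹ ≤ 1 := inv_le_one_of_one_le₀ h2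
    calc (1 : ℝ) ≤ K * (‖c - 1‖⁻¹ * ‖riemannZeta₁ c‖) := h1
      _ ≤ K * (1 * ‖riemannZeta₁ c‖) := by gcongr
      _ = _ := by ring
  have hT : 0 ≤ |t| := abs_nonneg t
  have hre : ∀ z ∈ Metric.ball c (3 / 2), 1 / 2 < z.re := by
    intro z hz
    rw [Metric.mem_ball, dist_eq_norm] at hz
    have h1 := (abs_le.mp (Complex.abs_re_le_norm (z - c))).1
    have h2 : (z - c).re = z.re - 2 := by simp [hcdef]
    linarith
  have hbound : ∀ z ∈ Metric.ball c (3 / 2),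
      ‖riemannZeta₁ z‖ ≤ (44 * (K + 1) * (1 + |t|) ^ 2) * ‖riemannZeta₁ c‖ := by
    intro z hz
    have h1 := norm_riemannZeta₁_le (hre z hz)
    rw [Metric.mem_ball, dist_eq_norm] at hz
    have h2 : ‖z‖ ≤ 4 * (1 + |t|) := by
      have h3 : ‖c‖ ≤ 2 + |t| := by
        have := Complex.norm_le_abs_re_add_abs_im c
        simpa [hcdef] using this
      have h4 : ‖z‖ ≤ ‖z - c‖ + ‖c‖ := by simpa using norm_add_le (z - c) c
      linarith
    have h5 : 0 ≤ ‖z‖ := norm_nonneg z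
    have h6 : ‖z‖ + 2 * ((‖z‖ + 1) * ‖z‖) ≤ 44 * (1 + |t|) ^ 2 := by nlinarith
    calc ‖riemannZeta₁ z‖ ≤ 44 * (1 + |t|) ^ 2 * 1 := by linarith
      _ ≤ 44 * (1 + |t|) ^ 2 * (K * ‖riemannZeta₁ c‖) := by gcongr
      _ ≤ 44 * (1 + |t|) ^ 2 * ((K + 1) * ‖riemannZeta₁ c‖) := by gcongr; linarith
      _ = _ := by ring
  have hB : 1 < 44 * (K + 1) * (1 + |t|) ^ 2 := by
    have : (1 : ℝ) ≤ (1 + |t|) ^ 2 := by nlinarith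
    nlinarith
  have hz : ‖s - c‖ ≤ 5 / 4 := by
    have h1 : s - c = ((s.re - 2 : ℝ) : ℂ) := by
      apply Complex.ext <;> simp [hcdef, t]
    rw [h1, Complex.norm_real, Real.norm_eq_abs, abs_le]
    constructor <;> linarith
  have main := norm_logDeriv_le_of_norm_le (r' := 11 / 8) hB (by norm_num) (by norm_num)
    (by norm_num) differentiable_riemannZeta₁.differentiableOn
    (fun z hz => hRH.riemannZeta₁_ne_zero (hre z hz)) hbound hz
  refine main.trans ?_
  have hlog := Real.log_le_rpow_div (x := 44 * (K + 1) * (1 + |t|) ^ 2) (by linarith)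
    (ε := 1 / 4) (by norm_num)
  have hpow : (44 * (K + 1) * (1 + |t|) ^ 2) ^ (1 / 4 : ℝ) =
      (44 * (K + 1)) ^ (1 / 4 : ℝ) * (1 + |t|) ^ (1 / 2 : ℝ) := by
    rw [Real.mul_rpow (by positivity) (by positivity), ← Real.rpow_natCast,
      ← Real.rpow_mul (by positivity)]
    norm_num
  rw [hpow] at hlog
  norm_num at hlog ⊢
  linarith

end ZetaGrowth

section PsiIntegral

open Chebyshev in
/-- The error term `ψ(t) - t`. -/
noncomputable def psiErr (t : ℝ) : ℝ := ψ t - t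

theorem measurable_psiErr : Measurable psiErr :=
  Chebyshev.psi_mono.measurable.sub measurable_id

theorem exists_abs_psiErr_le : ∃ C : ℝ, 0 < C ∧ ∀ t : ℝ, 0 ≤ t → |psiErr t| ≤ C * t := by
  refine ⟨Real.log 4 + 4 + 1, by positivity, fun t ht => ?_⟩
  have h1 := Chebyshev.psi_le_const_mul_self ht
  have h2 := Chebyshev.psi_nonneg t
  have h3 : 0 ≤ Real.log 4 := by positivity
  unfold psiErr
  rw [abs_le]
  constructor <;> nlinarith

theorem continuousOn_ofReal_cpow_const_Ioi_one (s : ℂ) :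
    ContinuousOn (fun t : ℝ => (t : ℂ) ^ s) (Set.Ioi 1) := fun t ht =>
  (Complex.continuousAt_ofReal_cpow_const t _
    (Or.inr (lt_trans one_pos ht).ne')).continuousWithinAt

theorem integrableOn_psiErr_mul_cpow {s : ℂ} (hs : 1 < s.re) :
    MeasureTheory.IntegrableOn (fun t : ℝ => (psiErr t : ℂ) * (t : ℂ) ^ (-(s + 1)))
      (Set.Ioi 1) := by
  obtain ⟨C, hC, hb⟩ := exists_abs_psiErr_le
  refine MeasureTheory.Integrable.mono'
    ((integrableOn_Ioi_rpow_of_lt (show -s.re < -1 by linarith) one_pos).const_mul C) ?_ ?_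
  · exact (Complex.measurable_ofReal.comp measurable_psiErr).aestronglyMeasurable.mul
      ((continuousOn_ofReal_cpow_const_Ioi_one _).aestronglyMeasurable measurableSet_Ioi)
  · refine (MeasureTheory.ae_restrict_mem measurableSet_Ioi).mono fun t ht => ?_
    have h0 : 0 < t := lt_trans one_pos ht
    rw [norm_mul, Complex.norm_cpow_eq_rpow_re_of_pos h0, Complex.norm_real, Real.norm_eq_abs]
    have h1 : t ^ (-s.re) = t * t ^ ((-(s + 1)).re) := by
      rw [mul_comm, ← Real.rpow_add_one h0.ne']
      congr 1
      simp
    rw [h1, ← mul_assoc]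
    gcongr
    exact hb t h0.le

theorem mul_integral_psiErr {s : ℂ} (hs : 1 < s.re) :
    s * ∫ t in Set.Ioi (1 : ℝ), (psiErr t : ℂ) * (t : ℂ) ^ (-(s + 1)) =
      -(deriv riemannZeta₁ s / riemannZeta₁ s) - 1 := by
  have hs1 : s ≠ 1 := by rintro rfl; simp at hs
  have hs2 : s - 1 ≠ 0 := sub_ne_zero.mpr hs1
  have hL := ArithmeticFunction.LSeries_vonMangoldt_eq_deriv_riemannZeta_div hs
  have hO : (fun n : ℕ => ∑ k ∈ Icc 1 n, ArithmeticFunction.vonMangoldt k) =O[atTop]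
      fun n : ℕ => (n : ℝ) ^ (1 : ℝ) := by
    apply Asymptotics.IsBigO.of_bound (Real.log 4 + 4)
    refine Eventually.of_forall fun n => ?_
    have h1 := Chebyshev.psi_le_const_mul_self (x := (n : ℝ)) n.cast_nonneg
    have h2 := Chebyshev.psi_nonneg (n : ℝ)
    rw [Chebyshev.psi, Nat.floor_natCast] at h1 h2
    rw [show Ioc 0 n = Icc 1 n from rfl] at h1 h2
    rw [Real.norm_eq_abs, abs_of_nonneg h2]
    simpa using h1
  have hI := LSeries_eq_mul_integral_of_nonneg (fun n => ArithmeticFunction.vonMangoldt n)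
    zero_le_one hs hO (fun n => ArithmeticFunction.vonMangoldt_nonneg)
  have h1 : ∀ t ∈ Set.Ioi (1 : ℝ),
      (∑ k ∈ Icc 1 ⌊t⌋₊, (ArithmeticFunction.vonMangoldt k : ℂ)) * (t : ℂ) ^ (-(s + 1)) =
      (psiErr t : ℂ) * (t : ℂ) ^ (-(s + 1)) + (t : ℂ) ^ (-s) := by
    intro t ht
    have h0' : (t : ℂ) ≠ 0 := by exact_mod_cast (lt_trans one_pos ht).ne'
    have h3 : (t : ℂ) ^ (-s) = (t : ℂ) ^ (-(s + 1)) * t := by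
      rw [neg_add, ← sub_eq_add_neg, Complex.cpow_sub _ _ h0', Complex.cpow_one]
      field_simp
    have h4 : (psiErr t : ℂ) = (∑ k ∈ Icc 1 ⌊t⌋₊, (ArithmeticFunction.vonMangoldt k : ℂ)) - t := by
      unfold psiErr
      rw [Chebyshev.psi]
      push_cast
      rfl
    rw [h3, h4]
    ring
  rw [MeasureTheory.setIntegral_congr_fun measurableSet_Ioi h1,
    MeasureTheory.integral_add (integrableOn_psiErr_mul_cpow hs)
      (integrableOn_Ioi_cpow_of_lt (by simpa using hs) one_pos),
    integral_Ioi_cpow_of_lt (by simpa using hs) one_pos] at hI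
  have hder : deriv riemannZeta s = -(s - 1)⁻¹ ^ 2 * riemannZeta₁ s +
      (s - 1)⁻¹ * deriv riemannZeta₁ s := by
    have h5 : HasDerivAt (fun w : ℂ => (w - 1)⁻¹ * riemannZeta₁ w)
        (-(s - 1)⁻¹ ^ 2 * riemannZeta₁ s + (s - 1)⁻¹ * deriv riemannZeta₁ s) s := by
      have := (((hasDerivAt_id s).sub_const 1).inv hs2).mul
        (differentiable_riemannZeta₁ s).hasDerivAt
      refine this.congr_deriv ?_
      simp only [id, Pi.inv_apply]
      field_simp
    refine (h5.congr_of_eventuallyEq ?_).deriv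
    filter_upwards [isOpen_ne.mem_nhds hs1] with w hw
    exact riemannZeta_eq_inv_sub_mul hw
  have hz : riemannZeta₁ s ≠ 0 := by
    intro h
    apply riemannZeta_ne_zero_of_one_lt_re hs
    rw [riemannZeta_eq_inv_sub_mul hs1, h, mul_zero]
  have h6 : LSeries (fun n => (ArithmeticFunction.vonMangoldt n : ℂ)) s =
      (s - 1)⁻¹ - deriv riemannZeta₁ s / riemannZeta₁ s := by
    rw [hL, hder, riemannZeta_eq_inv_sub_mul hs1]
    field_simp
    ring
  rw [h6] at hI
  have h7 : -s + 1 ≠ 0 := by intro h; apply hs2; linear_combination -h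
  simp only [Complex.ofReal_one, Complex.one_cpow] at hI
  rw [mul_add] at hI
  have h8 : s * (-1 / (-s + 1)) = 1 + (s - 1)⁻¹ := by
    have : -s + 1 = -(s - 1) := by ring
    rw [this]
    field_simp
    ring
  rw [h8] at hI
  linear_combination -hI

/-- The integrated error `∫_1^y (ψ(t) - t) dt`, extended by zero to `y ≤ 1`. -/
noncomputable def psiErrInt (y : ℝ) : ℝ := ∫ t in (1 : ℝ)..max 1 y, psiErr t

theorem intervalIntegrable_psiErr (a b : ℝ) :
    IntervalIntegrable psiErr MeasureTheory.volume a b :=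
  Chebyshev.psi_mono.intervalIntegrable.sub intervalIntegral.intervalIntegrable_id

theorem continuous_psiErrInt : Continuous psiErrInt :=
  (intervalIntegral.continuous_primitive intervalIntegrable_psiErr 1).comp
    (continuous_const.max continuous_id)

theorem psiErrInt_of_le_one {y : ℝ} (hy : y ≤ 1) : psiErrInt y = 0 := by
  simp [psiErrInt, hy]

/-- The kernel whose iterated integrals give the Mellin transform of `psiErrInt`. -/
noncomputable def psiKernel (s : ℂ) (p : ℝ × ℝ) : ℂ :=
  if p.2 ≤ p.1 then (p.1 : ℂ) ^ (-(s + 2)) * (psiErr p.2 : ℂ) else 0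

theorem integrable_psiKernel {s : ℂ} (hs : 1 < s.re) :
    MeasureTheory.Integrable (psiKernel s)
      ((MeasureTheory.volume.restrict (Set.Ioi 1)).prod
        (MeasureTheory.volume.restrict (Set.Ioi 1))) := by
  obtain ⟨C, hC, hb⟩ := exists_abs_psiErr_le
  set b : ℝ := (s.re - 1) / 2 with hbdef
  have hb0 : 0 < b := by simp only [hbdef]; linarith
  have h1 := (integrableOn_Ioi_rpow_of_lt (show b - s.re < -1 by simp only [hbdef]; linarith)
    one_pos).integrable
  have h2 := (integrableOn_Ioi_rpow_of_lt (show -1 - b < -1 by linarith) one_pos).integrable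
  refine MeasureTheory.Integrable.mono' ((h1.mul_prod h2).const_mul C) ?_ ?_
  · have hm : MeasureTheory.AEStronglyMeasurable
        (fun p : ℝ × ℝ => (p.1 : ℂ) ^ (-(s + 2)) * (psiErr p.2 : ℂ))
        ((MeasureTheory.volume.restrict (Set.Ioi 1)).prod
          (MeasureTheory.volume.restrict (Set.Ioi 1))) :=
      (((continuousOn_ofReal_cpow_const_Ioi_one _).aestronglyMeasurable
        measurableSet_Ioi).comp_fst).mul
        ((Complex.measurable_ofReal.comp measurable_psiErr).aestronglyMeasurable.comp_snd)
    exact hm.indicator (measurableSet_le measurable_snd measurable_fst)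
  · rw [MeasureTheory.Measure.prod_restrict]
    refine (MeasureTheory.ae_restrict_mem
      (measurableSet_Ioi.prod measurableSet_Ioi)).mono fun p hp => ?_
    obtain ⟨y, t⟩ := p
    simp only [Set.mem_prod, Set.mem_Ioi] at hp
    have hy : 0 < y := by linarith
    have ht : 0 < t := by linarith
    unfold psiKernel
    split_ifs with h
    · simp only at h ⊢
      rw [norm_mul, Complex.norm_cpow_eq_rpow_re_of_pos hy, Complex.norm_real, Real.norm_eq_abs]
      have h3 : (-(s + 2)).re = (b - s.re) - (2 + b) := by simp; ring
      have h4 : t = t ^ (2 + b) * t ^ (-1 - b) := by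
        rw [← Real.rpow_add ht]; ring_nf; simp
      have h5 : y ^ (b - s.re - (2 + b)) * y ^ (2 + b) = y ^ (b - s.re) := by
        rw [← Real.rpow_add hy]; ring_nf
      rw [h3]
      calc y ^ (b - s.re - (2 + b)) * |psiErr t|
          ≤ y ^ (b - s.re - (2 + b)) * (C * t) := by gcongr; exact hb t ht.le
        _ = C * (y ^ (b - s.re - (2 + b)) * (t ^ (2 + b) * t ^ (-1 - b))) := by
            rw [← h4]; ring
        _ ≤ C * (y ^ (b - s.re - (2 + b)) * (y ^ (2 + b) * t ^ (-1 - b))) := by gcongr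
        _ = C * (y ^ (b - s.re) * t ^ (-1 - b)) := by rw [← h5]; ring
    · rw [norm_zero]
      positivity

theorem integral_psiKernel_snd (s : ℂ) {y : ℝ} (hy : 1 < y) :
    ∫ t in Set.Ioi (1 : ℝ), psiKernel s (y, t) = (y : ℂ) ^ (-(s + 2)) * (psiErrInt y : ℂ) := by
  rw [psiErrInt, max_eq_right hy.le, ← intervalIntegral.integral_ofReal,
    ← intervalIntegral.integral_const_mul, intervalIntegral.integral_of_le hy.le,
    ← MeasureTheory.integral_indicator measurableSet_Ioi,
    ← MeasureTheory.integral_indicator measurableSet_Ioc]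
  congr 1
  ext t
  by_cases h1 : 1 < t <;> by_cases h2 : t ≤ y <;> simp [Set.indicator, psiKernel, h1, h2]

theorem integral_psiKernel_fst {s : ℂ} (hs : 1 < s.re) {t : ℝ} (ht : 1 < t) :
    ∫ y in Set.Ioi (1 : ℝ), psiKernel s (y, t) =
      (s + 1)⁻¹ * ((psiErr t : ℂ) * (t : ℂ) ^ (-(s + 1))) := by
  have h1 : ∫ y in Set.Ioi (1 : ℝ), psiKernel s (y, t) =
      ∫ y in Set.Ici t, (y : ℂ) ^ (-(s + 2)) * (psiErr t : ℂ) := by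
    rw [← MeasureTheory.integral_indicator measurableSet_Ioi,
      ← MeasureTheory.integral_indicator measurableSet_Ici]
    congr 1
    ext y
    by_cases h2 : t ≤ y
    · have : 1 < y := by linarith
      simp [Set.indicator, psiKernel, h2, this]
    · simp [Set.indicator, psiKernel, h2]
  have h2 : (-(s + 2)).re < -1 := by simp; linarith
  have h3 : -(s + 2) + 1 = -(s + 1) := by ring
  rw [h1, MeasureTheory.integral_Ici_eq_integral_Ioi, MeasureTheory.integral_mul_const,
    integral_Ioi_cpow_of_lt h2 (by linarith), h3, neg_div_neg_eq]
  ring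

theorem mellinConvergent_psiErrInt {s : ℂ} (hs : 1 < s.re) :
    MellinConvergent (fun y => (psiErrInt y : ℂ)) (-(s + 1)) := by
  have h1 := (integrable_psiKernel hs).integral_prod_left
  have h2 : MeasureTheory.IntegrableOn
      (fun y : ℝ => (y : ℂ) ^ (-(s + 2)) * (psiErrInt y : ℂ)) (Set.Ioi 1) :=
    MeasureTheory.IntegrableOn.congr_fun h1 (fun y hy => integral_psiKernel_snd s hy)
      measurableSet_Ioi
  unfold MellinConvergent
  have h3 : -(s + 1) - 1 = -(s + 2) := by ring
  rw [h3, ← Set.Ioc_union_Ioi_eq_Ioi zero_le_one]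
  refine MeasureTheory.IntegrableOn.union ?_ h2
  refine MeasureTheory.IntegrableOn.congr_fun MeasureTheory.integrableOn_zero (fun y hy => ?_)
    measurableSet_Ioc
  simp [psiErrInt_of_le_one hy.2]

theorem mellin_psiErrInt {s : ℂ} (hs : 1 < s.re) :
    mellin (fun y => (psiErrInt y : ℂ)) (-(s + 1)) =
      (-(deriv riemannZeta₁ s / riemannZeta₁ s) - 1) / (s * (s + 1)) := by
  have hs0 : s ≠ 0 := by rintro rfl; norm_num at hs
  have hs1 : s + 1 ≠ 0 := by
    intro h
    have := congrArg Complex.re h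
    simp at this
    linarith
  have h3 : -(s + 1) - 1 = -(s + 2) := by ring
  have h4 : mellin (fun y => (psiErrInt y : ℂ)) (-(s + 1)) =
      ∫ y in Set.Ioi (1 : ℝ), (y : ℂ) ^ (-(s + 2)) * (psiErrInt y : ℂ) := by
    rw [mellin, h3]
    simp only [smul_eq_mul]
    apply MeasureTheory.setIntegral_eq_of_subset_of_forall_sdiff_eq_zero measurableSet_Ioi
      (Set.Ioi_subset_Ioi zero_le_one)
    intro y hy
    simp [psiErrInt_of_le_one (not_lt.mp hy.2)]
  rw [h4, MeasureTheory.setIntegral_congr_fun measurableSet_Ioi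
    (fun y hy => (integral_psiKernel_snd s hy).symm),
    MeasureTheory.integral_integral_swap (f := fun y t => psiKernel s (y, t))
      (integrable_psiKernel hs),
    MeasureTheory.setIntegral_congr_fun measurableSet_Ioi
    (fun t ht => integral_psiKernel_fst hs ht), MeasureTheory.integral_const_mul,
    ← mul_integral_psiErr hs]
  field_simp

end PsiIntegral

section VerticalShift

theorem integrable_vertical_of_norm_le {f : ℂ → ℂ} {σ C r : ℝ} (hr : 1 < r)
    (hf : Continuous fun t : ℝ => f (σ + t * Complex.I))
    (hb : ∀ t : ℝ, ‖f (σ + t * Complex.I)‖ ≤ C * (1 + |t|) ^ (-r)) :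
    MeasureTheory.Integrable fun t : ℝ => f (σ + t * Complex.I) := by
  have h1 : MeasureTheory.Integrable fun t : ℝ => (1 + ‖t‖) ^ (-r) :=
    integrable_one_add_norm (by simpa using hr)
  exact (h1.const_mul C).mono' hf.aestronglyMeasurable (Eventually.of_forall hb)

/-- Moving the line of integration across a strip in which the integrand is holomorphic and
decays faster than `1 / |Im s|`. -/
theorem integral_vertical_eq_of_norm_le {f : ℂ → ℂ} {a b C r : ℝ} (hab : a ≤ b) (hr : 1 < r)
    (hf : DifferentiableOn ℂ f {z | a ≤ z.re ∧ z.re ≤ b})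
    (hb : ∀ z : ℂ, a ≤ z.re → z.re ≤ b → ‖f z‖ ≤ C * (1 + |z.im|) ^ (-r)) :
    ∫ t : ℝ, f (a + t * Complex.I) = ∫ t : ℝ, f (b + t * Complex.I) := by
  have hint : ∀ σ : ℝ, a ≤ σ → σ ≤ b →
      MeasureTheory.Integrable fun t : ℝ => f (σ + t * Complex.I) := by
    intro σ h1 h2
    refine integrable_vertical_of_norm_le (C := C) hr ?_ fun t => ?_
    · exact hf.continuousOn.comp_continuous (by fun_prop) fun t => by simp [h1, h2]
    · simpa using hb (σ + t * Complex.I) (by simpa using h1) (by simpa using h2)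
  have hlim : ∀ σ : ℝ, a ≤ σ → σ ≤ b →
      Tendsto (fun T : ℝ => ∫ t in (-T)..T, f (σ + t * Complex.I)) atTop
        (nhds (∫ t : ℝ, f (σ + t * Complex.I))) := fun σ h1 h2 =>
    MeasureTheory.intervalIntegral_tendsto_integral (hint σ h1 h2) tendsto_neg_atTop_atBot
      tendsto_id
  have hdecay : Tendsto (fun T : ℝ => C * (1 + T) ^ (-r) * |b - a|) atTop (nhds 0) := by
    have h1 : Tendsto (fun T : ℝ => (1 + T) ^ (-r)) atTop (nhds 0) :=
      (tendsto_rpow_neg_atTop (by linarith)).comp (tendsto_atTop_add_const_left _ _ tendsto_id)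
    simpa using (h1.const_mul C).mul_const |b - a|
  have hhor : ∀ c : ℝ → ℝ, (∀ T, 0 ≤ T → |c T| = T) →
      Tendsto (fun T : ℝ => ∫ x in a..b, f (x + (c T : ℝ) * Complex.I)) atTop (nhds 0) := by
    intro c hc
    refine squeeze_zero_norm' ?_ hdecay
    filter_upwards [eventually_ge_atTop 0] with T hT
    refine intervalIntegral.norm_integral_le_of_norm_le_const fun x hx => ?_
    rw [Set.uIoc_of_le hab] at hx
    have := hb (x + (c T : ℝ) * Complex.I) (by simpa using hx.1.le) (by simpa using hx.2)
    simpa [hc T hT] using this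
  have hneg := hhor (fun T => -T) fun T hT => by rw [abs_neg, abs_of_nonneg hT]
  have hpos := hhor (fun T => T) fun T hT => abs_of_nonneg hT
  have hrect : ∀ T : ℝ, (∫ x in a..b, f (x + ((-T : ℝ) : ℂ) * Complex.I)) -
      (∫ x in a..b, f (x + (T : ℂ) * Complex.I)) +
      Complex.I • (∫ t in (-T)..T, f (b + t * Complex.I)) -
      Complex.I • (∫ t in (-T)..T, f (a + t * Complex.I)) = 0 := by
    intro T
    have := Complex.integral_boundary_rect_eq_zero_of_differentiableOn f ⟨a, -T⟩ ⟨b, T⟩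
      (hf.mono fun z hz => by
        have := hz.1
        simpa [Set.uIcc_of_le hab] using this)
    simpa using this
  have h0 := ((hneg.sub hpos).add ((hlim b hab le_rfl).const_smul Complex.I)).sub
    ((hlim a le_rfl hab).const_smul Complex.I)
  have h1 := tendsto_nhds_unique (h0.congr hrect) tendsto_const_nhds
  simp only [sub_self, zero_add, smul_eq_mul] at h1
  exact (mul_left_cancel₀ Complex.I_ne_zero (sub_eq_zero.mp h1)).symm

end VerticalShift

section PsiBound

/-- The Mellin transform of `psiErrInt`, continued to `Re s > 1/2` under RH. -/
noncomputable def psiErrMellin (s : ℂ) : ℂ :=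
  (-(deriv riemannZeta₁ s / riemannZeta₁ s) - 1) / (s * (s + 1))

theorem RiemannHypothesis.differentiableAt_psiErrMellin (hRH : RiemannHypothesis) {s : ℂ}
    (hs : 1 / 2 < s.re) : DifferentiableAt ℂ psiErrMellin s := by
  have hd : DifferentiableAt ℂ (deriv riemannZeta₁) s :=
    differentiable_riemannZeta₁.contDiff.differentiable_deriv_two s
  have hs0 : s ≠ 0 := by rintro rfl; norm_num at hs
  have hs1 : s + 1 ≠ 0 := by
    intro h
    have := congrArg Complex.re h
    simp at this
    linarith
  unfold psiErrMellin
  exact (((hd.div (differentiable_riemannZeta₁ s)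
    (hRH.riemannZeta₁_ne_zero hs)).neg).sub_const 1).div (by fun_prop) (mul_ne_zero hs0 hs1)

theorem one_add_abs_im_le_four_mul_norm {s : ℂ} (hs : 1 / 2 ≤ s.re) : 1 + |s.im| ≤ 4 * ‖s‖ := by
  have h1 := Complex.abs_re_le_norm s
  have h2 := Complex.abs_im_le_norm s
  have h3 := le_abs_self s.re
  linarith

theorem RiemannHypothesis.exists_norm_psiErrMellin_le (hRH : RiemannHypothesis) :
    ∃ C : ℝ, 0 < C ∧ ∀ s : ℂ, 3 / 4 ≤ s.re → s.re ≤ 2 →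
      ‖psiErrMellin s‖ ≤ C * (1 + |s.im|) ^ (-(3 / 2) : ℝ) := by
  obtain ⟨C, hC, hb⟩ := hRH.exists_norm_logDeriv_riemannZeta₁_le
  refine ⟨16 * (C + 1), by positivity, fun s h1 h2 => ?_⟩
  have hx : 1 ≤ 1 + |s.im| := by linarith [abs_nonneg s.im]
  have h3 := one_add_abs_im_le_four_mul_norm (s := s) (by linarith)
  have h4 := one_add_abs_im_le_four_mul_norm (s := s + 1) (by simp; linarith)
  simp only [Complex.add_im, Complex.one_im, add_zero] at h4
  have h5 := hb s h1 h2
  set x := 1 + |s.im|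
  have hx0 : 0 < x := by linarith
  have h6 : (1 : ℝ) ≤ x ^ (1 / 2 : ℝ) := Real.one_le_rpow hx (by norm_num)
  have hnum : ‖-(deriv riemannZeta₁ s / riemannZeta₁ s) - 1‖ ≤ (C + 1) * x ^ (1 / 2 : ℝ) := by
    refine (norm_sub_le _ _).trans ?_
    rw [norm_neg, norm_one]
    linarith
  have hden : x ^ 2 / 16 ≤ ‖s * (s + 1)‖ := by
    rw [norm_mul]
    have := mul_le_mul h3 h4 hx0.le (by positivity)
    nlinarith
  have h7 : x ^ (1 / 2 : ℝ) = x ^ (-(3 / 2) : ℝ) * x ^ 2 := by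
    rw [← Real.rpow_natCast, ← Real.rpow_add hx0]
    norm_num
  unfold psiErrMellin
  rw [norm_div]
  calc _ ≤ (C + 1) * x ^ (1 / 2 : ℝ) / (x ^ 2 / 16) := by gcongr
    _ = _ := by rw [h7]; field_simp

theorem RiemannHypothesis.exists_abs_psiErrInt_le (hRH : RiemannHypothesis) :
    ∃ C : ℝ, 0 < C ∧ ∀ y : ℝ, 1 ≤ y → |psiErrInt y| ≤ C * y ^ (7 / 4 : ℝ) := by
  obtain ⟨C, hC, hb⟩ := hRH.exists_norm_psiErrMellin_le
  have hI : MeasureTheory.Integrable fun t : ℝ => (1 + |t|) ^ (-(3 / 2) : ℝ) :=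
    integrable_one_add_norm (r := 3 / 2) (by norm_num)
  set K : ℝ := ∫ t : ℝ, (1 + |t|) ^ (-(3 / 2) : ℝ) with hK
  have hK0 : 0 ≤ K := MeasureTheory.integral_nonneg fun t => by positivity
  refine ⟨1 / (2 * Real.pi) * (C * K) + 1, by positivity, fun y hy => ?_⟩
  have hy0 : 0 < y := by linarith
  have hy0' : (y : ℂ) ≠ 0 := by exact_mod_cast hy0.ne'
  have hmel : ∀ t : ℝ, mellin (fun y => (psiErrInt y : ℂ)) (((-3 : ℝ) : ℂ) + t * Complex.I) =
      psiErrMellin ((2 : ℝ) + (-t : ℝ) * Complex.I) := by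
    intro t
    rw [psiErrMellin, ← mellin_psiErrInt (by simp)]
    congr 1
    push_cast
    ring
  have hdiff : DifferentiableOn ℂ psiErrMellin {z | 3 / 4 ≤ z.re ∧ z.re ≤ 2} := fun z hz =>
    (hRH.differentiableAt_psiErrMellin (by linarith [hz.1])).differentiableWithinAt
  have hvert : MeasureTheory.Integrable fun t : ℝ => psiErrMellin ((2 : ℝ) + t * Complex.I) := by
    refine integrable_vertical_of_norm_le (C := C) (r := 3 / 2) (by norm_num) ?_ fun t => ?_
    · exact hdiff.continuousOn.comp_continuous (by fun_prop) fun t => by simp; norm_num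
    · simpa using hb ((2 : ℝ) + t * Complex.I) (by simp; norm_num) (by simp)
  have hinv := mellinInv_mellin_eq (-3) (fun y => (psiErrInt y : ℂ)) hy0
    (by
      have := mellinConvergent_psiErrInt (s := 2) (by simp)
      convert this using 1
      push_cast
      ring)
    (by
      unfold Complex.VerticalIntegrable
      simp only [hmel]
      exact hvert.comp_neg)
    (Complex.continuous_ofReal.comp continuous_psiErrInt).continuousAt
  set F : ℂ → ℂ := fun s => (y : ℂ) ^ (s + 1) * psiErrMellin s with hF
  have hnormF : ∀ s : ℂ, 3 / 4 ≤ s.re → s.re ≤ 2 →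
      ‖F s‖ ≤ y ^ (s.re + 1) * (C * (1 + |s.im|) ^ (-(3 / 2) : ℝ)) := by
    intro s h1 h2
    simp only [hF]
    rw [norm_mul, Complex.norm_cpow_eq_rpow_re_of_pos hy0, Complex.add_re, Complex.one_re]
    gcongr
    exact hb s h1 h2
  have h1 : mellinInv (-3) (mellin fun y => (psiErrInt y : ℂ)) y =
      (1 / (2 * Real.pi)) • ∫ t : ℝ, F ((2 : ℝ) + t * Complex.I) := by
    rw [mellinInv, ← MeasureTheory.integral_neg_eq_self
      (fun t : ℝ => F ((2 : ℝ) + t * Complex.I))]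
    congr 2
    ext t
    simp only [hF, smul_eq_mul, hmel]
    congr 2
    push_cast
    ring
  have hshift : ∫ t : ℝ, F ((3 / 4 : ℝ) + t * Complex.I) = ∫ t : ℝ, F ((2 : ℝ) + t * Complex.I) := by
    refine integral_vertical_eq_of_norm_le (C := y ^ (3 : ℝ) * C) (r := 3 / 2) (by norm_num)
      (by norm_num) ?_ fun z hz1 hz2 => ?_
    · refine DifferentiableOn.mul ?_ hdiff
      exact (DifferentiableOn.const_cpow (by fun_prop) (Or.inl hy0'))
    · refine (hnormF z hz1 hz2).trans ?_
      rw [mul_assoc]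
      gcongr
      linarith
  have h2 : ‖∫ t : ℝ, F ((3 / 4 : ℝ) + t * Complex.I)‖ ≤ y ^ (7 / 4 : ℝ) * C * K := by
    rw [hK, ← MeasureTheory.integral_const_mul]
    refine MeasureTheory.norm_integral_le_of_norm_le (hI.const_mul _)
      (Eventually.of_forall fun t => ?_)
    have := hnormF ((3 / 4 : ℝ) + t * Complex.I) (by simp) (by simp; norm_num)
    simp only [Complex.add_re, Complex.ofReal_re, Complex.re_ofReal_mul, Complex.I_re, mul_zero,
      add_zero, Complex.add_im, Complex.ofReal_im, Complex.im_ofReal_mul, Complex.I_im, mul_one,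
      zero_add] at this
    norm_num at this ⊢
    linarith
  have h3 : |psiErrInt y| ≤ 1 / (2 * Real.pi) * (y ^ (7 / 4 : ℝ) * C * K) := by
    rw [← Real.norm_eq_abs, ← Complex.norm_real, ← hinv, h1, ← hshift, norm_smul,
      Real.norm_of_nonneg (by positivity)]
    gcongr
  have : 0 ≤ y ^ (7 / 4 : ℝ) := by positivity
  linarith

end PsiBound

section PrimeNumberTheorem

theorem psiErrInt_sub_mem_Icc {a b : ℝ} (ha : 1 ≤ a) (hab : a ≤ b) :
    psiErrInt b - psiErrInt a ∈
      Set.Icc ((b - a) * (Chebyshev.psi a - b)) ((b - a) * (Chebyshev.psi b - a)) := by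
  have h1 : psiErrInt b - psiErrInt a = ∫ t in a..b, psiErr t := by
    rw [psiErrInt, psiErrInt, max_eq_right ha, max_eq_right (ha.trans hab)]
    exact intervalIntegral.integral_interval_sub_left (intervalIntegrable_psiErr _ _)
      (intervalIntegrable_psiErr _ _)
  have hc : ∀ c : ℝ, (b - a) * c = ∫ _ in a..b, c := fun c => by simp
  rw [h1, hc, hc]
  constructor
  · refine intervalIntegral.integral_mono_on hab (by simp) (intervalIntegrable_psiErr _ _)
      fun t ht => ?_
    have := Chebyshev.psi_mono ht.1
    unfold psiErr
    linarith [ht.2]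
  · refine intervalIntegral.integral_mono_on hab (intervalIntegrable_psiErr _ _) (by simp)
      fun t ht => ?_
    have := Chebyshev.psi_mono ht.2
    unfold psiErr
    linarith [ht.1]

theorem RiemannHypothesis.exists_abs_psiErr_le (hRH : RiemannHypothesis) :
    ∃ C : ℝ, 0 < C ∧ ∀ t : ℝ, 0 ≤ t → |psiErr t| ≤ C * t ^ (7 / 8 : ℝ) := by
  obtain ⟨C, hC, hb⟩ := hRH.exists_abs_psiErrInt_le
  obtain ⟨D, hD, hd⟩ := _root_.exists_abs_psiErr_le
  refine ⟨5 * C + 1 + 2 * D, by positivity, fun x hx0 => ?_⟩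
  rcases hx0.eq_or_lt with rfl | hx
  · simpa using hd 0 le_rfl
  set h := x ^ (7 / 8 : ℝ) with hh
  have hpos : 0 < h := by positivity
  have hsplit : h * x ^ (1 / 8 : ℝ) = x := by
    rw [hh, ← Real.rpow_add hx]
    norm_num
  have h256 : (256 : ℝ) ^ (1 / 8 : ℝ) = 2 := by
    rw [show (256 : ℝ) = 2 ^ (8 : ℝ) by norm_num, ← Real.rpow_mul (by norm_num)]
    norm_num
  rcases le_total x 256 with hle | hge
  · have h1 : x ^ (1 / 8 : ℝ) ≤ 2 := h256 ▸ Real.rpow_le_rpow hx0 hle (by norm_num)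
    have h2 : x ≤ h * 2 := by
      calc x = h * x ^ (1 / 8 : ℝ) := hsplit.symm
        _ ≤ h * 2 := by gcongr
    have h3 := hd x hx0
    nlinarith [mul_pos hC hpos]
  · have h1 : 2 ≤ x ^ (1 / 8 : ℝ) := h256 ▸ Real.rpow_le_rpow (by norm_num) hge (by norm_num)
    have h2 : h * 2 ≤ x := by
      calc h * 2 ≤ h * x ^ (1 / 8 : ℝ) := by gcongr
        _ = x := hsplit
    have hsq : x ^ (7 / 4 : ℝ) = h * h := by
      rw [hh, ← Real.rpow_add hx]
      norm_num
    have h4 : (2 * x) ^ (7 / 4 : ℝ) ≤ 4 * (h * h) := by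
      rw [Real.mul_rpow (by norm_num) hx0, hsq]
      have : (2 : ℝ) ^ (7 / 4 : ℝ) ≤ 2 ^ (2 : ℝ) :=
        Real.rpow_le_rpow_of_exponent_le (by norm_num) (by norm_num)
      norm_num at this ⊢
      gcongr
    have hI : ∀ y : ℝ, 1 ≤ y → y ≤ 2 * x → |psiErrInt y| ≤ C * (4 * (h * h)) := by
      intro y hy1 hy2
      refine (hb y hy1).trans ?_
      gcongr
      exact (Real.rpow_le_rpow (by linarith) hy2 (by norm_num)).trans h4
    have hx1 := hb x (by linarith)
    rw [hsq] at hx1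
    have hr := abs_le.mp (hI (x + h) (by linarith) (by linarith))
    have hl := abs_le.mp (hI (x - h) (by linarith) (by linarith))
    have hm := abs_le.mp hx1
    have e1 := (psiErrInt_sub_mem_Icc (a := x) (b := x + h) (by linarith) (by linarith)).1
    have e2 := (psiErrInt_sub_mem_Icc (a := x - h) (b := x) (by linarith) (by linarith)).2
    have k1 : h * (Chebyshev.psi x - (x + h)) ≤ h * (5 * C * h) := by
      rw [add_sub_cancel_left] at e1
      linarith [hr.2, hm.1]
    have k2 : h * (-(5 * C * h)) ≤ h * (Chebyshev.psi x - (x - h)) := by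
      rw [sub_sub_cancel] at e2
      linarith [hl.2, hm.1]
    have k1' := le_of_mul_le_mul_left k1 hpos
    have k2' := le_of_mul_le_mul_left k2 hpos
    have : 0 < D * h := by positivity
    unfold psiErr
    rw [abs_le]
    constructor <;> linarith

theorem RiemannHypothesis.exists_abs_theta_sub_le (hRH : RiemannHypothesis) :
    ∃ C : ℝ, 0 < C ∧ ∀ n : ℕ, |Chebyshev.theta n - n| ≤ C * (n : ℝ) ^ (7 / 8 : ℝ) := by
  obtain ⟨C, hC, hb⟩ := hRH.exists_abs_psiErr_le
  obtain ⟨D, hD⟩ := Chebyshev.psi_sub_theta_le_mul_sqrt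
  refine ⟨C + |D|, by positivity, fun n => ?_⟩
  have h1 := abs_le.mp (hb n n.cast_nonneg)
  have h2 := hD n
  have h3 := Chebyshev.theta_le_psi n
  have h4 : √(n : ℝ) ≤ (n : ℝ) ^ (7 / 8 : ℝ) := by
    rcases n.eq_zero_or_pos with rfl | hn
    · simp
    · rw [Real.sqrt_eq_rpow]
      exact Real.rpow_le_rpow_of_exponent_le (by exact_mod_cast hn) (by norm_num)
  have h5 : D * √(n : ℝ) ≤ |D| * (n : ℝ) ^ (7 / 8 : ℝ) :=
    mul_le_mul (le_abs_self D) h4 (by positivity) (abs_nonneg D)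
  unfold psiErr at h1
  have h6 : 0 ≤ |D| * (n : ℝ) ^ (7 / 8 : ℝ) := by positivity
  rw [abs_le]
  constructor <;> linarith

end PrimeNumberTheorem

section Combinatorics

/-- The weight `log p` at primes `p`, zero elsewhere. -/
noncomputable def primeLog (p : ℕ) : ℝ := if p.Prime then Real.log p else 0

theorem primeLog_nonneg (p : ℕ) : 0 ≤ primeLog p := by
  unfold primeLog
  split_ifs
  · exact Real.log_natCast_nonneg p
  · exact le_rfl

theorem primeLog_le_log (p : ℕ) : primeLog p ≤ Real.log p := by
  unfold primeLog
  split_ifs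
  · exact le_rfl
  · exact Real.log_natCast_nonneg p

theorem sum_range_succ_primeLog (n : ℕ) :
    ∑ p ∈ range (n + 1), primeLog p = Chebyshev.theta n := by
  rw [Chebyshev.theta_eq_sum_Icc, Nat.floor_natCast, sum_filter]
  refine sum_congr ?_ fun p _ => rfl
  ext p
  simp

theorem r22'_eq_of_le {n M : ℕ} (h : n ≤ M) :
    r22' n = ∑ p ∈ range (M + 1), ∑ m ∈ Icc 1 M, if p ^ 2 + m ^ 2 = n then primeLog p else 0 := by
  have hp : ∀ p : ℕ, p ≤ p ^ 2 := fun p => Nat.le_self_pow two_ne_zero p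
  unfold r22'
  rw [← sum_subset (range_subset_range.mpr (Nat.succ_le_succ h))]
  · refine sum_congr rfl fun p _ => ?_
    rw [← sum_subset (Icc_subset_Icc_right h)]
    · refine sum_congr rfl fun m _ => ?_
      unfold primeLog
      rw [← ite_and]
      simp only [and_comm]
    · intro m hm hm'
      rw [if_neg]
      intro hn
      simp only [mem_Icc, not_and, not_le] at hm hm'
      have := hm' hm.1
      have := hp m
      omega
  · intro p _ hp'
    refine sum_eq_zero fun m _ => if_neg fun hn => ?_
    simp only [mem_range, not_lt] at hp'
    have := hp p
    omega

theorem card_filter_sq_add_sq_mem_Ioc {N M : ℕ} (p : ℕ) :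
    #{m ∈ Icc 1 M | p ^ 2 + m ^ 2 ∈ Ioc N M} = Nat.sqrt (M - p ^ 2) - Nat.sqrt (N - p ^ 2) := by
  rw [← Nat.card_Ioc]
  congr 1
  ext m
  have h1 : Nat.sqrt (N - p ^ 2) < m ↔ N - p ^ 2 < m ^ 2 := Nat.sqrt_lt'
  have h2 : m ≤ Nat.sqrt (M - p ^ 2) ↔ m ^ 2 ≤ M - p ^ 2 := Nat.le_sqrt'
  have h3 : m ≤ m ^ 2 := Nat.le_self_pow two_ne_zero m
  have h4 : 0 < m → 0 < m ^ 2 := fun h => by positivity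
  have h5 : m = 0 → m ^ 2 = 0 := by rintro rfl; rfl
  simp only [mem_filter, mem_Icc, mem_Ioc, h1, h2]
  omega

theorem sum_Ioc_r22' (N M : ℕ) :
    ∑ n ∈ Ioc N M, r22' n = ∑ p ∈ range (M + 1),
      primeLog p * (Nat.sqrt (M - p ^ 2) - Nat.sqrt (N - p ^ 2) : ℕ) := by
  rw [sum_congr rfl fun n hn => r22'_eq_of_le (mem_Ioc.mp hn).2, sum_comm]
  refine sum_congr rfl fun p _ => ?_
  rw [sum_comm, ← card_filter_sq_add_sq_mem_Ioc, card_filter, Nat.cast_sum, mul_sum]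
  refine sum_congr rfl fun m _ => ?_
  rw [sum_ite_eq]
  split_ifs <;> simp

/-- The length of the vertical chord at abscissa `k` in the quarter annulus
`N < x² + y² ≤ M`. -/
noncomputable def annulusChord (N M k : ℕ) : ℝ := √((M : ℝ) - k ^ 2) - √((N : ℝ) - k ^ 2)

theorem sqrt_cast_tsub_sq (N k : ℕ) : √((N - k ^ 2 : ℕ) : ℝ) = √((N : ℝ) - k ^ 2) := by
  rcases le_total (k ^ 2) N with h | h
  · push_cast [Nat.cast_sub h]
    rfl
  · have h' : (N : ℝ) ≤ (k : ℝ) ^ 2 := by exact_mod_cast h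
    rw [Nat.sub_eq_zero_of_le h, Nat.cast_zero, Real.sqrt_zero,
      Real.sqrt_eq_zero_of_nonpos (by linarith)]

theorem abs_natSqrt_sub_annulusChord_le {N M : ℕ} (h : N ≤ M) (k : ℕ) :
    |((Nat.sqrt (M - k ^ 2) - Nat.sqrt (N - k ^ 2) : ℕ) : ℝ) - annulusChord N M k| ≤ 1 := by
  have h1 : Nat.sqrt (N - k ^ 2) ≤ Nat.sqrt (M - k ^ 2) :=
    Nat.sqrt_le_sqrt (Nat.sub_le_sub_right h _)
  have h2 := Real.nat_sqrt_le_real_sqrt (a := M - k ^ 2)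
  have h3 := Real.nat_sqrt_le_real_sqrt (a := N - k ^ 2)
  have h4 := Real.real_sqrt_le_nat_sqrt_succ (a := M - k ^ 2)
  have h5 := Real.real_sqrt_le_nat_sqrt_succ (a := N - k ^ 2)
  rw [sqrt_cast_tsub_sq] at h2 h3 h4 h5
  rw [Nat.cast_sub h1, annulusChord, abs_le]
  constructor <;> linarith

theorem sq_lt_of_natSqrt_lt {M k : ℕ} (h : Nat.sqrt M < k) : M < k ^ 2 := Nat.sqrt_lt'.mp h

theorem abs_sum_r22'_sub_sum_annulusChord_le {N M : ℕ} (h : N ≤ M) :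
    |∑ n ∈ Ioc N M, r22' n - ∑ k ∈ range (Nat.sqrt M + 1), primeLog k * annulusChord N M k| ≤
      Chebyshev.theta (Nat.sqrt M) := by
  have h1 : ∑ n ∈ Ioc N M, r22' n = ∑ p ∈ range (Nat.sqrt M + 1),
      primeLog p * (Nat.sqrt (M - p ^ 2) - Nat.sqrt (N - p ^ 2) : ℕ) := by
    rw [sum_Ioc_r22']
    refine (sum_subset (range_subset_range.mpr (Nat.succ_le_succ (Nat.sqrt_le_self M)))
      fun p _ hp => ?_).symm
    have : M < p ^ 2 := sq_lt_of_natSqrt_lt (by simpa [Nat.lt_succ_iff] using hp)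
    simp [Nat.sub_eq_zero_of_le this.le]
  rw [h1, ← sum_sub_distrib, ← sum_range_succ_primeLog]
  refine (abs_sum_le_sum_abs _ _).trans (sum_le_sum fun p _ => ?_)
  rw [← mul_sub, abs_mul, abs_of_nonneg (primeLog_nonneg p)]
  exact mul_le_of_le_one_right (primeLog_nonneg p) (abs_natSqrt_sub_annulusChord_le h p)

end Combinatorics

section QuarterDisc

theorem integral_sqrt_one_sub_sq_zero_one : ∫ x in (0 : ℝ)..1, √(1 - x ^ 2) = Real.pi / 4 := by
  have hc : Continuous fun x : ℝ => √(1 - x ^ 2) := by fun_prop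
  have h1 := intervalIntegral.integral_add_adjacent_intervals
    (hc.intervalIntegrable (-1) 0 (μ := MeasureTheory.volume)) (hc.intervalIntegrable 0 1)
  have h2 := intervalIntegral.integral_comp_neg (a := 0) (b := 1) fun x : ℝ => √(1 - x ^ 2)
  rw [integral_sqrt_one_sub_sq] at h1
  simp only [even_two, Even.neg_pow, neg_zero] at h2
  linarith

theorem integral_sqrt_sub_sq {M c : ℝ} (hM : 0 ≤ M) (hc : √M ≤ c) :
    ∫ t in (0 : ℝ)..c, √(M - t ^ 2) = Real.pi / 4 * M := by
  have hcont : Continuous fun t : ℝ => √(M - t ^ 2) := by fun_prop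
  have h1 := intervalIntegral.smul_integral_comp_mul_left (a := 0) (b := 1)
    (fun t : ℝ => √(M - t ^ 2)) (√M)
  have h2 : ∀ x : ℝ, √(M - (√M * x) ^ 2) = √M * √(1 - x ^ 2) := fun x => by
    rw [← Real.sqrt_mul hM, mul_pow, Real.sq_sqrt hM]
    ring_nf
  simp only [h2, mul_zero, mul_one, intervalIntegral.integral_const_mul,
    integral_sqrt_one_sub_sq_zero_one, smul_eq_mul] at h1
  have h3 : ∫ t in (√M)..c, √(M - t ^ 2) = 0 := by
    rw [intervalIntegral.integral_congr (g := fun _ => (0 : ℝ))]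
    · simp
    · intro t ht
      rw [Set.uIcc_of_le hc] at ht
      exact Real.sqrt_eq_zero_of_nonpos (by nlinarith [Real.sq_sqrt hM, Real.sqrt_nonneg M, ht.1])
  rw [← intervalIntegral.integral_add_adjacent_intervals (hcont.intervalIntegrable 0 (√M))
    (hcont.intervalIntegrable _ c), h3, ← h1, ← mul_assoc, Real.mul_self_sqrt hM]
  ring

theorem antitoneOn_sqrt_sub_sq (M : ℝ) : AntitoneOn (fun t : ℝ => √(M - t ^ 2)) (Set.Ici 0) := by
  intro a ha b _ hab
  have ha' : (0 : ℝ) ≤ a := ha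
  exact Real.sqrt_le_sqrt (by nlinarith)

theorem sum_range_sqrt_sub_sq_mem_Icc {M : ℝ} {R : ℕ} (hM : 0 ≤ M) (hR : √M ≤ R) :
    ∑ k ∈ range R, √(M - k ^ 2) ∈ Set.Icc (Real.pi / 4 * M) (Real.pi / 4 * M + √M) := by
  have hanti : AntitoneOn (fun t : ℝ => √(M - t ^ 2)) (Set.Icc 0 (0 + (R : ℝ))) :=
    (antitoneOn_sqrt_sub_sq M).mono Set.Icc_subset_Ici_self
  have h1 := hanti.integral_le_sum
  have h2 := hanti.sum_le_integral
  simp only [zero_add] at h1 h2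
  rw [integral_sqrt_sub_sq hM hR] at h1 h2
  refine ⟨h1, ?_⟩
  have h3 := sum_range_succ (fun k : ℕ => √(M - (k : ℝ) ^ 2)) R
  rw [sum_range_succ'] at h3
  simp only [CharP.cast_eq_zero, ne_eq, OfNat.ofNat_ne_zero, not_false_eq_true, zero_pow,
    sub_zero] at h3
  linarith [Real.sqrt_nonneg (M - (R : ℝ) ^ 2)]

theorem abs_sum_annulusChord_sub_le {N M : ℕ} (h : N ≤ M) :
    |∑ k ∈ range (Nat.sqrt M + 1), annulusChord N M k - Real.pi / 4 * ((M : ℝ) - N)| ≤ √M := by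
  have hM : √(M : ℝ) ≤ (Nat.sqrt M + 1 : ℕ) := by
    simpa using Real.real_sqrt_le_nat_sqrt_succ (a := M)
  have hNM : √(N : ℝ) ≤ √M := Real.sqrt_le_sqrt (by exact_mod_cast h)
  have h1 := sum_range_sqrt_sub_sq_mem_Icc M.cast_nonneg hM
  have h2 := sum_range_sqrt_sub_sq_mem_Icc N.cast_nonneg (hNM.trans hM)
  simp only [annulusChord, sum_sub_distrib]
  rw [abs_le]
  constructor <;> linarith [h1.1, h1.2, h2.1, h2.2]

end QuarterDisc

section Unimodal

theorem sqrt_sub_sqrt_le_sqrt_sub_sqrt {a b d : ℝ} (hd : 0 ≤ d) (hdb : d ≤ b) (hba : b ≤ a) :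
    √a - √b ≤ √(a - d) - √(b - d) := by
  have h : √a + √(b - d) ≤ √(a - d) + √b := by
    refine abs_le_of_sq_le_sq' ?_ (by positivity) |>.2
    rw [add_sq, add_sq, Real.sq_sqrt (by linarith), Real.sq_sqrt (by linarith),
      Real.sq_sqrt (by linarith), Real.sq_sqrt (by linarith), mul_assoc, mul_assoc,
      ← Real.sqrt_mul (by linarith), ← Real.sqrt_mul (by linarith)]
    have : √(a * (b - d)) ≤ √((a - d) * b) := Real.sqrt_le_sqrt (by nlinarith)
    linarith
  linarith

theorem annulusChord_nonneg {N M : ℕ} (h : N ≤ M) (k : ℕ) : 0 ≤ annulusChord N M k := by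
  have h' : (N : ℝ) ≤ M := by exact_mod_cast h
  exact sub_nonneg.mpr (Real.sqrt_le_sqrt (by linarith))

theorem annulusChord_le_succ {N M k : ℕ} (h : N ≤ M) (hk : k < Nat.sqrt N) :
    annulusChord N M k ≤ annulusChord N M (k + 1) := by
  have h' : (N : ℝ) ≤ M := by exact_mod_cast h
  have hk' : ((k : ℝ) + 1) ^ 2 ≤ N := by exact_mod_cast Nat.le_sqrt'.mp hk
  have := sqrt_sub_sqrt_le_sqrt_sub_sqrt (a := (M : ℝ) - k ^ 2) (b := (N : ℝ) - k ^ 2)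
    (d := 2 * k + 1) (by positivity) (by linarith) (by linarith)
  unfold annulusChord
  push_cast
  convert this using 3 <;> ring

theorem annulusChord_eq_of_natSqrt_lt {N M k : ℕ} (hk : Nat.sqrt N < k) :
    annulusChord N M k = √((M : ℝ) - k ^ 2) := by
  have : (N : ℝ) ≤ (k : ℝ) ^ 2 := by exact_mod_cast (sq_lt_of_natSqrt_lt hk).le
  rw [annulusChord, Real.sqrt_eq_zero_of_nonpos (x := (N : ℝ) - _) (by linarith), sub_zero]

theorem annulusChord_succ_le {N M k : ℕ} (hk : Nat.sqrt N < k) :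
    annulusChord N M (k + 1) ≤ annulusChord N M k := by
  rw [annulusChord_eq_of_natSqrt_lt hk, annulusChord_eq_of_natSqrt_lt (hk.trans k.lt_succ_self)]
  refine antitoneOn_sqrt_sub_sq M (Set.mem_Ici.mpr k.cast_nonneg)
    (Set.mem_Ici.mpr (k + 1).cast_nonneg) ?_
  exact_mod_cast k.le_succ

theorem annulusChord_mul_sqrt_le {N M : ℕ} (h : N ≤ M) (k : ℕ) :
    annulusChord N M k * √((M : ℝ) - k ^ 2) ≤ M - N := by
  have h' : (N : ℝ) ≤ M := by exact_mod_cast h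
  unfold annulusChord
  rcases le_total ((N : ℝ) - k ^ 2) 0 with h1 | h1
  · rw [Real.sqrt_eq_zero_of_nonpos h1, sub_zero]
    rcases le_total ((M : ℝ) - k ^ 2) 0 with h2 | h2
    · rw [Real.sqrt_eq_zero_of_nonpos h2]
      linarith
    · rw [Real.mul_self_sqrt h2]
      linarith
  · have h2 := Real.mul_self_sqrt h1
    have h3 := Real.mul_self_sqrt (show 0 ≤ (M : ℝ) - k ^ 2 by linarith)
    have h4 : √((N : ℝ) - k ^ 2) ≤ √((M : ℝ) - k ^ 2) := Real.sqrt_le_sqrt (by linarith)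
    nlinarith [Real.sqrt_nonneg ((N : ℝ) - k ^ 2)]

theorem annulusChord_le_sqrt {N M : ℕ} (h : N ≤ M) (k : ℕ) :
    annulusChord N M k ≤ √((M : ℝ) - N) := by
  have h1 := annulusChord_mul_sqrt_le h k
  have h2 : annulusChord N M k ≤ √((M : ℝ) - k ^ 2) := sub_le_self _ (Real.sqrt_nonneg _)
  refine Real.le_sqrt_of_sq_le ?_
  nlinarith [annulusChord_nonneg h k]

/-- The total variation of a nonnegative sequence bounded by `F` and unimodal around `q`. -/
theorem sum_abs_sub_le_of_unimodal {f : ℕ → ℝ} {q m : ℕ} {F : ℝ} (h0 : ∀ k, 0 ≤ f k)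
    (hF : ∀ k ≤ m, f k ≤ F) (hmono : ∀ k < q, f k ≤ f (k + 1))
    (hanti : ∀ k > q, f (k + 1) ≤ f k) :
    ∑ k ∈ range m, |f (k + 1) - f k| ≤ 3 * F := by
  suffices H : ∀ n ≤ m, (n ≤ q → ∑ k ∈ range n, |f (k + 1) - f k| ≤ f n) ∧
      ∑ k ∈ range n, |f (k + 1) - f k| ≤ 3 * F - f n by
    linarith [(H m le_rfl).2, h0 m]
  intro n
  induction n with
  | zero =>
    intro _
    have := hF 0 m.zero_le
    have := h0 0
    simp only [range_zero, sum_empty]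
    exact ⟨fun _ => by assumption, by linarith⟩
  | succ n ih =>
    intro hn
    obtain ⟨ih1, ih2⟩ := ih (n.le_succ.trans hn)
    rw [sum_range_succ]
    have b1 := hF (n + 1) hn
    have b2 := hF n (n.le_succ.trans hn)
    have b3 := h0 n
    have b4 := h0 (n + 1)
    rcases lt_trichotomy n q with h | h | h
    · have h1 := ih1 h.le
      have h2 := hmono n h
      rw [abs_of_nonneg (by linarith)]
      exact ⟨fun _ => by linarith, by linarith⟩
    · have h1 := ih1 h.le
      refine ⟨fun h' => by omega, ?_⟩
      rcases abs_cases (f (n + 1) - f n) with h2 | h2 <;> linarith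
    · have h2 := hanti n h
      rw [abs_of_nonpos (by linarith)]
      exact ⟨fun h' => by omega, by linarith⟩

theorem abs_sum_mul_le_of_abs_sum_le {f b : ℕ → ℝ} {A : ℝ} {n : ℕ}
    (hA : ∀ m ≤ n, |∑ k ∈ range (m + 1), b k| ≤ A) :
    |∑ k ∈ range (n + 1), f k * b k| ≤ A * (|f n| + ∑ k ∈ range n, |f (k + 1) - f k|) := by
  have h1 : ∀ m, ∑ k ∈ range (m + 1), f k * b k = f m * ∑ k ∈ range (m + 1), b k -
      ∑ k ∈ range m, (f (k + 1) - f k) * ∑ j ∈ range (k + 1), b j := by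
    intro m
    induction m with
    | zero => simp
    | succ m ih =>
      rw [sum_range_succ, ih, sum_range_succ _ (m + 1),
        sum_range_succ (fun k => (f (k + 1) - f k) * _) m]
      ring
  rw [h1, mul_add, mul_sum (range n) _ A]
  refine (abs_sub _ _).trans (add_le_add ?_ ((abs_sum_le_sum_abs _ _).trans
    (sum_le_sum fun k hk => ?_)))
  · rw [abs_mul, mul_comm]
    exact mul_le_mul_of_nonneg_right (hA n le_rfl) (abs_nonneg _)
  · rw [abs_mul, mul_comm]
    exact mul_le_mul_of_nonneg_right (hA k (mem_range.mp hk).le) (abs_nonneg _)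

end Unimodal

section ShortIntervals

theorem annulusChord_le_div {N M j k : ℕ} (h : N ≤ M) (hj : 0 < j) (hk : k + j ≤ Nat.sqrt M) :
    annulusChord N M k ≤ ((M : ℝ) - N) / √((j : ℝ) * Nat.sqrt M) := by
  have h1 : (k : ℝ) + j ≤ (Nat.sqrt M : ℕ) := by exact_mod_cast hk
  have h2 : ((Nat.sqrt M : ℕ) : ℝ) ^ 2 ≤ M := by exact_mod_cast Nat.sqrt_le' M
  have hj' : (0 : ℝ) < j := by exact_mod_cast hj
  have hk' : (0 : ℝ) ≤ k := k.cast_nonneg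
  rw [le_div_iff₀ (Real.sqrt_pos.mpr (by nlinarith))]
  refine le_trans ?_ (annulusChord_mul_sqrt_le h k)
  refine mul_le_mul_of_nonneg_left (Real.sqrt_le_sqrt ?_) (annulusChord_nonneg h k)
  nlinarith

theorem sum_range_one_div_sqrt_succ_le (u : ℕ) :
    ∑ j ∈ range u, 1 / √((j : ℝ) + 1) ≤ 2 * √(u : ℝ) := by
  induction u with
  | zero => simp
  | succ u ih =>
    rw [sum_range_succ]
    have h0 : 0 < √((u : ℝ) + 1) := Real.sqrt_pos.mpr (by positivity)
    have h1 := Real.sq_sqrt (show (0 : ℝ) ≤ u by positivity)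
    have h2 := Real.sq_sqrt (show (0 : ℝ) ≤ u + 1 by positivity)
    have h3 : 1 / √((u : ℝ) + 1) ≤ 2 * √((u : ℝ) + 1) - 2 * √(u : ℝ) := by
      rw [div_le_iff₀ h0]
      nlinarith [sq_nonneg (√((u : ℝ) + 1) - √(u : ℝ))]
    push_cast
    linarith

theorem sum_annulusChord_near_le {N M u : ℕ} (h : N ≤ M) (hu : u < Nat.sqrt M) :
    ∑ x ∈ range u, annulusChord N M (Nat.sqrt M - u + x) ≤
      ((M : ℝ) - N) * (2 * √(u : ℝ)) / √(Nat.sqrt M : ℝ) := by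
  have h' : (0 : ℝ) ≤ (M : ℝ) - N := sub_nonneg.mpr (by exact_mod_cast h)
  rw [← sum_range_reflect]
  calc _ ≤ ∑ j ∈ range u, ((M : ℝ) - N) / √(Nat.sqrt M : ℝ) * (1 / √((j : ℝ) + 1)) := by
        refine sum_le_sum fun j hj => ?_
        have hj' := mem_range.mp hj
        refine (annulusChord_le_div h j.succ_pos (by omega)).trans_eq ?_
        rw [Real.sqrt_mul (by positivity)]
        push_cast
        field_simp
    _ = ((M : ℝ) - N) / √(Nat.sqrt M : ℝ) * ∑ j ∈ range u, 1 / √((j : ℝ) + 1) := by rw [mul_sum]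
    _ ≤ ((M : ℝ) - N) / √(Nat.sqrt M : ℝ) * (2 * √(u : ℝ)) := by
        gcongr
        exact sum_range_one_div_sqrt_succ_le u
    _ = _ := by ring

theorem abs_primeLog_sub_one_le {k M : ℕ} (hk : k ≤ M) :
    |primeLog k - 1| ≤ 1 + Real.log M := by
  have h1 := primeLog_nonneg k
  have h2 := primeLog_le_log k
  have h3 : Real.log k ≤ Real.log M := by
    rcases k.eq_zero_or_pos with rfl | hk0
    · simpa using Real.log_natCast_nonneg M
    · exact Real.log_le_log (by exact_mod_cast hk0) (by exact_mod_cast hk)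
  rw [abs_le]
  constructor <;> linarith

theorem RiemannHypothesis.exists_abs_sum_primeLog_sub_one_le (hRH : RiemannHypothesis) :
    ∃ C : ℝ, 0 < C ∧ ∀ R m : ℕ, 0 < R → m ≤ R →
      |∑ k ∈ range (m + 1), (primeLog k - 1)| ≤ C * (R : ℝ) ^ (7 / 8 : ℝ) := by
  obtain ⟨C, hC, hb⟩ := hRH.exists_abs_theta_sub_le
  refine ⟨C + 1, by positivity, fun R m hR hm => ?_⟩
  have h1 := hb m
  have h2 : (m : ℝ) ^ (7 / 8 : ℝ) ≤ (R : ℝ) ^ (7 / 8 : ℝ) := by gcongr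
  have h3 : (1 : ℝ) ≤ (R : ℝ) ^ (7 / 8 : ℝ) :=
    Real.one_le_rpow (by exact_mod_cast hR) (by norm_num)
  rw [sum_sub_distrib, sum_range_succ_primeLog]
  simp only [sum_const, card_range, nsmul_eq_mul, mul_one]
  push_cast
  rw [abs_le] at h1 ⊢
  constructor <;> nlinarith [h1.1, h1.2]

theorem RiemannHypothesis.exists_abs_sum_primeLog_sub_one_mul_annulusChord_le
    (hRH : RiemannHypothesis) :
    ∃ C : ℝ, 0 < C ∧ ∀ N M : ℕ, 0 < M → N ≤ M →
      |∑ k ∈ range (Nat.sqrt M + 1), annulusChord N M k * (primeLog k - 1)| ≤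
        C * ((1 + Real.log M) * (√((M : ℝ) - N) +
          ((M : ℝ) - N) * (Nat.sqrt M : ℝ) ^ (-(1 / 16) : ℝ))) := by
  obtain ⟨C, hC, hb⟩ := hRH.exists_abs_sum_primeLog_sub_one_le
  refine ⟨4 * C + 4, by positivity, fun N M hM h => ?_⟩
  set R := Nat.sqrt M with hRdef
  have hR : 0 < R := Nat.sqrt_pos.mpr hM
  have hR1 : (1 : ℝ) ≤ R := by exact_mod_cast hR
  have hR0 : (0 : ℝ) < R := by linarith
  have hH : (0 : ℝ) ≤ (M : ℝ) - N := sub_nonneg.mpr (by exact_mod_cast h)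
  have hlog : 0 ≤ Real.log M := Real.log_natCast_nonneg M
  set D : ℝ := (M : ℝ) - N with hD
  set P : ℝ := (R : ℝ) ^ (7 / 8 : ℝ) with hP
  have hP0 : 0 < P := by positivity
  have hP1 : 1 ≤ P := Real.one_le_rpow hR1 (by norm_num)
  obtain ⟨u, hu⟩ : ∃ u, ⌈P⌉₊ = u + 1 :=
    Nat.exists_eq_succ_of_ne_zero (Nat.ceil_pos.mpr hP0).ne'
  have hPu : P ≤ (u + 1 : ℕ) := hu ▸ Nat.le_ceil P
  have hPu' : ((u + 1 : ℕ) : ℝ) ≤ P + 1 := hu ▸ (Nat.ceil_lt_add_one hP0.le).le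
  have huR : u + 1 ≤ R := by
    rw [← hu, Nat.ceil_le, hP]
    exact (Real.rpow_le_rpow_of_exponent_le hR1 (by norm_num)).trans_eq (Real.rpow_one _)
  set n := R - (u + 1) with hn
  set F : ℝ := D / √(P * R) with hF
  have hchord : ∀ k ≤ n, annulusChord N M k ≤ F := by
    intro k hk
    refine (annulusChord_le_div h u.succ_pos (by omega)).trans ?_
    rw [hF]
    gcongr
  have hsplit : ∑ k ∈ range (R + 1), annulusChord N M k * (primeLog k - 1) =
      ∑ k ∈ range (n + 1), annulusChord N M k * (primeLog k - 1) +
      ∑ x ∈ range u, annulusChord N M (R - u + x) * (primeLog (R - u + x) - 1) +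
      annulusChord N M R * (primeLog R - 1) := by
    have e1 : R = n + 1 + u := by omega
    have e2 : R - u = n + 1 := by omega
    rw [sum_range_succ, e2]
    congr 1
    conv_lhs => rw [e1]
    exact sum_range_add _ _ _
  have hfar : |∑ k ∈ range (n + 1), annulusChord N M k * (primeLog k - 1)| ≤
      C * P * (4 * F) := by
    refine (abs_sum_mul_le_of_abs_sum_le (A := C * P) fun m hm => hb R m hR (by omega)).trans ?_
    have h1 := sum_abs_sub_le_of_unimodal (f := annulusChord N M) (q := Nat.sqrt N) (m := n)
      (annulusChord_nonneg h) hchord (fun k hk => annulusChord_le_succ h hk)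
      (fun k hk => annulusChord_succ_le hk)
    have h2 := hchord n le_rfl
    rw [abs_of_nonneg (annulusChord_nonneg h n)]
    gcongr
    linarith
  have hRM : R ≤ M := Nat.sqrt_le_self M
  have hnear : |∑ x ∈ range u, annulusChord N M (R - u + x) * (primeLog (R - u + x) - 1)| ≤
      (1 + Real.log M) * (D * (2 * √(u : ℝ)) / √(R : ℝ)) := by
    refine le_trans ?_ (mul_le_mul_of_nonneg_left
      (sum_annulusChord_near_le h (by omega)) (by positivity))
    rw [mul_sum]
    refine (abs_sum_le_sum_abs _ _).trans (sum_le_sum fun x hx => ?_)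
    have := mem_range.mp hx
    rw [abs_mul, abs_of_nonneg (annulusChord_nonneg h _), mul_comm]
    exact mul_le_mul_of_nonneg_right (abs_primeLog_sub_one_le (by omega))
      (annulusChord_nonneg h _)
  have hlast : |annulusChord N M R * (primeLog R - 1)| ≤ (1 + Real.log M) * √D := by
    rw [abs_mul, abs_of_nonneg (annulusChord_nonneg h _), mul_comm]
    exact mul_le_mul (abs_primeLog_sub_one_le hRM) (annulusChord_le_sqrt h R)
      (annulusChord_nonneg h _) (by positivity)
  set ρ : ℝ := (R : ℝ) ^ (-(1 / 16) : ℝ) with hρ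
  have hρ0 : 0 < ρ := by positivity
  have hPF : P * F = D * ρ := by
    have : √(P * R) * ρ = P := by
      rw [Real.sqrt_eq_rpow, hP, ← Real.rpow_add_one hR0.ne', ← Real.rpow_mul hR0.le, hρ,
        ← Real.rpow_add hR0]
      norm_num
    have h0 : 0 < √(P * R) := by positivity
    rw [hF]
    field_simp
    linear_combination D * -this
  have hu2 : √(u : ℝ) / √(R : ℝ) ≤ ρ := by
    have h1 : (u : ℝ) ≤ P := by
      push_cast at hPu'
      linarith
    have h2 : √P / √(R : ℝ) = ρ := by
      rw [← Real.sqrt_div hP0.le, Real.sqrt_eq_rpow, hP, hρ]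
      nth_rewrite 2 [← Real.rpow_one (R : ℝ)]
      rw [← Real.rpow_sub hR0, ← Real.rpow_mul hR0.le]
      norm_num
    rw [← h2]
    gcongr
  have hnear' : (1 + Real.log M) * (D * (2 * √(u : ℝ)) / √(R : ℝ)) ≤
      (1 + Real.log M) * (2 * (D * ρ)) := by
    refine mul_le_mul_of_nonneg_left ?_ (by positivity)
    calc D * (2 * √(u : ℝ)) / √(R : ℝ) = 2 * (D * (√(u : ℝ) / √(R : ℝ))) := by ring
      _ ≤ 2 * (D * ρ) := by gcongr
  have hfar' : C * P * (4 * F) ≤ 4 * C * ((1 + Real.log M) * (D * ρ)) := by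
    have : 0 ≤ 4 * C * (Real.log M * (D * ρ)) := by positivity
    linear_combination 4 * C * hPF + this
  have h3 : 0 ≤ (1 + Real.log M) * √D := by positivity
  have h4 : 0 ≤ (1 + Real.log M) * (D * ρ) := by positivity
  rw [hsplit]
  refine (abs_add_three _ _ _).trans ?_
  have h5 : 0 ≤ C * ((1 + Real.log M) * √D) := by positivity
  linarith

theorem RiemannHypothesis.exists_abs_sum_Ioc_r22'_sub_le (hRH : RiemannHypothesis) :
    ∃ C : ℝ, 0 < C ∧ ∀ N M : ℕ, 0 < M → N ≤ M →
      |∑ n ∈ Ioc N M, r22' n - Real.pi / 4 * ((M : ℝ) - N)| ≤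
        C * (√(M : ℝ) + (1 + Real.log M) * (√((M : ℝ) - N) +
          ((M : ℝ) - N) * (Nat.sqrt M : ℝ) ^ (-(1 / 16) : ℝ))) := by
  obtain ⟨C, hC, hb⟩ := hRH.exists_abs_sum_primeLog_sub_one_mul_annulusChord_le
  refine ⟨C + Real.log 4 + 1, by positivity, fun N M hM h => ?_⟩
  have h1 := abs_sum_r22'_sub_sum_annulusChord_le h
  have h2 := abs_sum_annulusChord_sub_le h
  have h3 := hb N M hM h
  have h4 : Chebyshev.theta (Nat.sqrt M) ≤ Real.log 4 * √(M : ℝ) :=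
    (Chebyshev.theta_le_log4_mul_x (Nat.cast_nonneg _)).trans
      (mul_le_mul_of_nonneg_left Real.nat_sqrt_le_real_sqrt (by positivity))
  have h5 : ∑ k ∈ range (Nat.sqrt M + 1), annulusChord N M k * (primeLog k - 1) =
      ∑ k ∈ range (Nat.sqrt M + 1), primeLog k * annulusChord N M k -
      ∑ k ∈ range (Nat.sqrt M + 1), annulusChord N M k := by
    rw [← sum_sub_distrib]
    exact sum_congr rfl fun k _ => by ring
  rw [h5] at h3
  have hH : (0 : ℝ) ≤ (M : ℝ) - N := sub_nonneg.mpr (by exact_mod_cast h)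
  have hlog : 0 ≤ Real.log M := Real.log_natCast_nonneg M
  set E := (1 + Real.log M) * (√((M : ℝ) - N) +
    ((M : ℝ) - N) * (Nat.sqrt M : ℝ) ^ (-(1 / 16) : ℝ))
  have hE : 0 ≤ E := by positivity
  have hCs : 0 ≤ C * √(M : ℝ) := by positivity
  have h6 : 0 ≤ Real.log 4 * E := by positivity
  rw [abs_le] at h1 h2 h3 ⊢
  constructor <;> linarith [h1.1, h1.2, h2.1, h2.2, h3.1, h3.2]

end ShortIntervals

/-- Assuming RH, `∑_{n=N+1}^{N+H} r'_{2,2}(n) = (π/4) H`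
`+ O(H²/N + H log log N / (log N)^{1/2})` as `N → ∞`, uniformly for
`N^{1/2} (log N)² = o(H)` and `H = o(N)`. -/
theorem prime_square_plus_square_short_intervals
    (hRH : RiemannHypothesis) (H : ℕ → ℕ)
    (hlow : Tendsto (fun N : ℕ => (N : ℝ) ^ ((1 : ℝ) / 2) * Real.log N ^ 2 / H N) atTop (nhds 0))
    (hupp : Tendsto (fun N : ℕ => (H N : ℝ) / N) atTop (nhds 0)) :
    (fun N : ℕ => (∑ n ∈ Finset.Ioc N (N + H N), r22' n) - Real.pi / 4 * H N)
      =O[atTop]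
    (fun N : ℕ => (H N : ℝ) ^ 2 / N +
      (H N : ℝ) * Real.log (Real.log N) / Real.log N ^ ((1 : ℝ) / 2)) := by
  obtain ⟨C, hC, hb⟩ := hRH.exists_abs_sum_Ioc_r22'_sub_le
  have hlogN : Tendsto (fun N : ℕ => Real.log N) atTop atTop :=
    Real.tendsto_log_atTop.comp tendsto_natCast_atTop_atTop
  have hsmall := ((isLittleO_log_rpow_rpow_atTop 2 (show (0 : ℝ) < 1 / 64 by norm_num)).comp_tendsto
    (tendsto_natCast_atTop_atTop (R := ℝ))).bound one_pos
  refine IsBigO.of_bound (8 * C) ?_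
  filter_upwards [hlogN.eventually_ge_atTop (Real.exp 1), hsmall, eventually_ge_atTop 16,
    hlow.eventually_le_const one_pos, hupp.eventually_le_const one_pos] with N hL hsm hN hlo hup
  rcases (H N).eq_zero_or_pos with h0 | hpos
  · simp [h0]
  have hN16 : (16 : ℝ) ≤ N := by exact_mod_cast hN
  have hN0 : (0 : ℝ) < N := by linarith
  have hH : (0 : ℝ) < H N := by exact_mod_cast hpos
  set L := Real.log N with hLdef
  have hL1 : 1 ≤ L := (Real.one_le_exp zero_le_one).trans hL
  have hL0 : 0 < L := by linarith
  have hLL : 1 ≤ Real.log L := (Real.le_log_iff_exp_le hL0).mpr hL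
  simp only [Function.comp_apply, Real.norm_eq_abs, one_mul] at hsm
  rw [abs_of_nonneg (by positivity), abs_of_nonneg (by positivity)] at hsm
  have hsm' : L ^ 2 ≤ (N : ℝ) ^ (1 / 64 : ℝ) := by exact_mod_cast hsm
  rw [div_le_one hH, ← Real.sqrt_eq_rpow] at hlo
  rw [div_le_one hN0] at hup
  have hMcast : ((N + H N : ℕ) : ℝ) = N + H N := by push_cast; rfl
  have hLsqrt : L ^ 2 ≤ √(N : ℝ) := by
    rw [Real.sqrt_eq_rpow]
    exact hsm'.trans (Real.rpow_le_rpow_of_exponent_le (by linarith) (by norm_num))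
  have hsqrtM : √((N + H N : ℕ) : ℝ) ≤ 2 * (H N / L) := by
    have h1 : √((N + H N : ℕ) : ℝ) ≤ 2 * √(N : ℝ) := by
      rw [show (2 : ℝ) * √(N : ℝ) = √(4 * N) by
        rw [Real.sqrt_mul (by norm_num), show (4 : ℝ) = 2 ^ 2 by norm_num,
          Real.sqrt_sq (by norm_num)], hMcast]
      exact Real.sqrt_le_sqrt (by linarith)
    have h2 : √(N : ℝ) ≤ H N / L := by
      rw [le_div_iff₀ hL0]
      refine le_trans ?_ hlo
      gcongr
      nlinarith
    linarith
  have hlogM : 1 + Real.log ((N + H N : ℕ) : ℝ) ≤ 3 * L := by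
    have h1 : Real.log ((N + H N : ℕ) : ℝ) ≤ Real.log (2 * N) := by
      rw [hMcast]
      exact Real.log_le_log (by positivity) (by linarith)
    rw [Real.log_mul two_ne_zero hN0.ne'] at h1
    have := Real.log_two_lt_d9
    linarith
  have hsqrtH : √(H N : ℝ) ≤ H N / L ^ 2 := by
    have h1 : L ^ 2 ≤ √(H N : ℝ) := by
      refine Real.le_sqrt_of_sq_le (le_trans ?_ hlo)
      rw [sq]
      gcongr
    rw [le_div_iff₀ (by positivity)]
    calc √(H N : ℝ) * L ^ 2 ≤ √(H N : ℝ) * √(H N : ℝ) := by gcongr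
      _ = H N := Real.mul_self_sqrt hH.le
  have hR : (Nat.sqrt (N + H N) : ℝ) ^ (-(1 / 16) : ℝ) ≤ 1 / L ^ 2 := by
    have h1 : (N : ℝ) ^ (1 / 4 : ℝ) ≤ (Nat.sqrt (N + H N) : ℝ) := by
      have e1 : √(N : ℝ) = (N : ℝ) ^ (1 / 4 : ℝ) * (N : ℝ) ^ (1 / 4 : ℝ) := by
        rw [Real.sqrt_eq_rpow, ← Real.rpow_add hN0]
        norm_num
      have e2 : (2 : ℝ) ≤ (N : ℝ) ^ (1 / 4 : ℝ) := by
        calc (2 : ℝ) = 16 ^ (1 / 4 : ℝ) := by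
              rw [show (16 : ℝ) = 2 ^ (4 : ℝ) by norm_num, ← Real.rpow_mul (by norm_num)]
              norm_num
          _ ≤ _ := Real.rpow_le_rpow (by norm_num) hN16 (by norm_num)
      have e3 := Real.real_sqrt_le_nat_sqrt_succ (a := N + H N)
      have e4 : √(N : ℝ) ≤ √((N + H N : ℕ) : ℝ) := Real.sqrt_le_sqrt (by rw [hMcast]; linarith)
      nlinarith
    have h2 : 0 < (N : ℝ) ^ (1 / 4 : ℝ) := by positivity
    rw [Real.rpow_neg (by positivity), ← one_div]
    refine one_div_le_one_div_of_le (by positivity) (hsm'.trans ?_)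
    calc (N : ℝ) ^ (1 / 64 : ℝ) = ((N : ℝ) ^ (1 / 4 : ℝ)) ^ (1 / 16 : ℝ) := by
          rw [← Real.rpow_mul hN0.le]
          norm_num
      _ ≤ _ := Real.rpow_le_rpow h2.le h1 (by norm_num)
  have hmain := hb N (N + H N) (by omega) (by omega)
  have hsub : ((N + H N : ℕ) : ℝ) - N = H N := by rw [hMcast]; ring
  rw [hsub] at hmain
  have hbound : √((N + H N : ℕ) : ℝ) + (1 + Real.log ((N + H N : ℕ) : ℝ)) * (√(H N : ℝ) +
      (H N : ℝ) * (Nat.sqrt (N + H N) : ℝ) ^ (-(1 / 16) : ℝ)) ≤ 8 * (H N / L) := by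
    have h1 : (1 + Real.log ((N + H N : ℕ) : ℝ)) * (√(H N : ℝ) +
        (H N : ℝ) * (Nat.sqrt (N + H N) : ℝ) ^ (-(1 / 16) : ℝ)) ≤
        3 * L * (H N / L ^ 2 + H N * (1 / L ^ 2)) := by
      gcongr
    have h2 : 3 * L * (H N / L ^ 2 + H N * (1 / L ^ 2)) = 6 * (H N / L) := by
      field_simp
      ring
    linarith
  have hgoal : (H N : ℝ) / L ≤ (H N : ℝ) * Real.log L / L ^ ((1 : ℝ) / 2) := by
    have h1 : L ^ ((1 : ℝ) / 2) ≤ L :=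
      (Real.rpow_le_rpow_of_exponent_le hL1 (by norm_num)).trans_eq (Real.rpow_one L)
    gcongr
    exact le_mul_of_one_le_right hH.le hLL
  have hsq : 0 ≤ (H N : ℝ) ^ 2 / N := by positivity
  rw [Real.norm_eq_abs, Real.norm_eq_abs]
  calc _ ≤ C * (8 * (H N / L)) := hmain.trans (by gcongr)
    _ = 8 * C * (H N / L) := by ring
    _ ≤ _ := by
      gcongr
      exact (hgoal.trans (le_add_of_nonneg_left hsq)).trans (le_abs_self _)
end

section
/- Let N be a positive integer and μ > 0 a real number. Then ∫_{−1/2}^{1/2} z^{−μ} e(−nα) dα = e^{−n/N} n^{μ−1}/Γ(μ) + O_μ(1/n), uniformly for integers n ≥ 1, where z = 1/N − 2πiα. -/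
open Complex MeasureTheory

/-- The Gamma integral with a complex rate in the right half-plane, obtained from the real case by
the identity theorem. -/
lemma integral_rpow_mul_cexp_neg_mul_Ioi {ν : ℝ} (hν : 0 < ν) {z : ℂ} (hz : 0 < z.re) :
    ∫ t : ℝ in Set.Ioi 0, ((t ^ (ν - 1) : ℝ) : ℂ) * cexp (-(z * t)) =
      z ^ (-(ν : ℂ)) * Complex.Gamma ν := by
  set m : Measure ℝ :=
    (volume.restrict (Set.Ioi 0)).withDensity (fun t ↦ ENNReal.ofReal (t ^ (ν - 1))) with hm
  have hmeas : Measurable fun t : ℝ ↦ ENNReal.ofReal (t ^ (ν - 1)) := by fun_prop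
  have hfin : ∀ᵐ t ∂(volume.restrict (Set.Ioi (0 : ℝ))), ENNReal.ofReal (t ^ (ν - 1)) < ⊤ :=
    ae_of_all _ fun _ ↦ ENNReal.ofReal_lt_top
  have hmgf (w : ℂ) : ProbabilityTheory.complexMGF id m w =
      ∫ t : ℝ in Set.Ioi 0, ((t ^ (ν - 1) : ℝ) : ℂ) * cexp (w * t) := by
    rw [ProbabilityTheory.complexMGF, hm, integral_withDensity_eq_integral_toReal_smul hmeas hfin]
    refine setIntegral_congr_fun measurableSet_Ioi fun t ht ↦ ?_
    have : 0 ≤ t ^ (ν - 1) := Real.rpow_nonneg (le_of_lt ht) _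
    simp [ENNReal.toReal_ofReal this]
  have hset : Set.Iio 0 ⊆ interior (ProbabilityTheory.integrableExpSet id m) := by
    refine interior_maximal (fun r hr ↦ ?_) isOpen_Iio
    change Integrable _ m
    rw [hm, integrable_withDensity_iff_integrable_smul' hmeas hfin]
    have := integrableOn_rpow_mul_exp_neg_mul_rpow (p := 1) (s := ν - 1) (b := -r)
      (by linarith) one_pos (by simpa using hr)
    refine (integrableOn_congr_fun (fun t ht ↦ ?_) measurableSet_Ioi).mp this
    have : 0 ≤ t ^ (ν - 1) := Real.rpow_nonneg (le_of_lt ht) _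
    simp [ENNReal.toReal_ofReal this]
  have hU : Convex ℝ {w : ℂ | w.re < 0} := convex_halfSpace_re_lt 0
  have hO : IsOpen {w : ℂ | w.re < 0} := isOpen_lt continuous_re continuous_const
  have h1 : AnalyticOnNhd ℂ (ProbabilityTheory.complexMGF id m) {w : ℂ | w.re < 0} := fun w hw ↦
    ProbabilityTheory.analyticAt_complexMGF (hset hw)
  have h2 : AnalyticOnNhd ℂ (fun w : ℂ ↦ (-w) ^ (-(ν : ℂ)) * Complex.Gamma ν)
      {w : ℂ | w.re < 0} := by
    refine DifferentiableOn.analyticOnNhd (fun w hw ↦ ?_) hO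
    refine DifferentiableAt.differentiableWithinAt ?_
    refine DifferentiableAt.mul_const (DifferentiableAt.cpow_const differentiableAt_id.neg ?_) _
    left
    simpa using hw
  have hreal (r : ℝ) (hr : r < 0) :
      ProbabilityTheory.complexMGF id m r = (-(r : ℂ)) ^ (-(ν : ℂ)) * Complex.Gamma ν := by
    rw [hmgf]
    have := Complex.integral_cpow_mul_exp_neg_mul_Ioi (a := ν) (r := -r)
      (by simpa using hν) (by linarith)
    rw [one_div, Complex.inv_cpow, ← Complex.cpow_neg] at this
    · push_cast at this
      rw [← this]
      refine setIntegral_congr_fun measurableSet_Ioi fun t ht ↦ ?_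
      rw [Complex.ofReal_cpow (le_of_lt ht)]
      simp
    · rw [Complex.arg_ofReal_of_nonneg (by linarith)]
      exact Real.pi_ne_zero.symm
  have hfreq : ∃ᶠ w in nhdsWithin (-1 : ℂ) {-1}ᶜ, ProbabilityTheory.complexMGF id m w =
      (-w) ^ (-(ν : ℂ)) * Complex.Gamma ν := by
    have ht : Filter.Tendsto (fun r : ℝ ↦ (r : ℂ)) (nhdsWithin (-1) {-1}ᶜ)
        (nhdsWithin (-1 : ℂ) {-1}ᶜ) := by
      refine tendsto_nhdsWithin_of_tendsto_nhds_of_eventually_within _ ?_ ?_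
      · exact (by simpa using (Complex.continuous_ofReal.tendsto (-1))
          : Filter.Tendsto (fun r : ℝ ↦ (r : ℂ)) (nhds (-1)) (nhds (-1 : ℂ))).mono_left
          nhdsWithin_le_nhds
      · filter_upwards [self_mem_nhdsWithin] with r hr
        intro h
        exact hr (Complex.ofReal_injective (by simpa using h))
    refine ht.frequently (Filter.Eventually.frequently ?_)
    refine nhdsWithin_le_nhds ?_
    filter_upwards [Iio_mem_nhds (show (-1 : ℝ) < 0 by norm_num)] with r hr using hreal r hr
  have := h1.eqOn_of_preconnected_of_frequently_eq h2 hU.isPreconnected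
    (show (-1 : ℂ) ∈ {w : ℂ | w.re < 0} by simp) hfreq
    (show -z ∈ {w : ℂ | w.re < 0} by simpa using hz)
  simp only [hmgf, neg_neg] at this
  simpa using this

lemma one_add_abs_mul_le_norm {δ c : ℝ} (hδ : 0 < δ) (hδ' : δ ≤ 1) (hc : 2 * δ ≤ c) (α : ℝ) :
    δ * (1 + |α|) ≤ ‖(c : ℂ) - 2 * Real.pi * I * α‖ := by
  have hre := Complex.abs_re_le_norm ((c : ℂ) - 2 * Real.pi * I * α)
  have him := Complex.abs_im_le_norm ((c : ℂ) - 2 * Real.pi * I * α)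
  simp [abs_mul, abs_of_pos Real.pi_pos] at hre him
  have := le_abs_self c
  nlinarith [Real.pi_gt_three, abs_nonneg α,
    mul_nonneg (sub_nonneg.2 hδ') (abs_nonneg α),
    mul_nonneg (sub_nonneg.2 Real.pi_gt_three.le) (abs_nonneg α)]

lemma one_add_abs_le_norm {c α : ℝ} (hα : 1 / 2 ≤ |α|) :
    1 + |α| ≤ ‖(c : ℂ) - 2 * Real.pi * I * α‖ := by
  have him := Complex.abs_im_le_norm ((c : ℂ) - 2 * Real.pi * I * α)
  simp [abs_mul, abs_of_pos Real.pi_pos] at him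
  nlinarith [Real.pi_gt_three]

lemma sub_mem_slitPlane {c : ℝ} (hc : 0 < c) (α : ℝ) :
    (c : ℂ) - 2 * Real.pi * I * α ∈ slitPlane := by
  left
  simpa using hc

lemma integrable_cpow_neg {ν c : ℝ} (hν : 1 < ν) (hc : 0 < c) :
    Integrable fun α : ℝ ↦ ((c : ℂ) - 2 * Real.pi * I * α) ^ (-(ν : ℂ)) := by
  set δ := min 1 (c / 2) with hδ
  have h0 : 0 < δ := by positivity
  have hint : Integrable fun α : ℝ ↦ δ ^ (-ν) * (1 + ‖α‖) ^ (-ν) :=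
    (integrable_one_add_norm (by simpa using hν)).const_mul _
  refine hint.mono' (Continuous.aestronglyMeasurable ?_) (ae_of_all _ fun α ↦ ?_)
  · exact Continuous.cpow (by fun_prop) continuous_const fun α ↦ sub_mem_slitPlane hc α
  · rw [← ofReal_neg, norm_cpow_real, ← Real.mul_rpow h0.le (by positivity)]
    exact Real.rpow_le_rpow_of_nonpos (by positivity)
      (one_add_abs_mul_le_norm h0 (min_le_left _ _) (by linarith [min_le_right 1 (c / 2)]) α)
      (by linarith)

open FourierTransform in
/-- Laplace's integral for `1 / Γ(ν)`, by Fourier inversion. -/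
lemma integral_cpow_neg_mul_cexp {ν c x : ℝ} (hν : 1 < ν) (hc : 0 < c) (hx : 0 < x) :
    ∫ α : ℝ, ((c : ℂ) - 2 * Real.pi * I * α) ^ (-(ν : ℂ)) * cexp (-(2 * Real.pi * I * x * α)) =
      cexp (-(x * c)) * (x : ℂ) ^ ((ν : ℂ) - 1) / Complex.Gamma ν := by
  set f : ℝ → ℂ := (Set.Ioi 0).indicator
    fun t ↦ ((t ^ (ν - 1) * Real.exp (-c * t) : ℝ) : ℂ) with hf
  have hfint : Integrable f := by
    rw [hf, integrable_indicator_iff measurableSet_Ioi]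
    have := integrableOn_rpow_mul_exp_neg_mul_rpow (p := 1) (s := ν - 1) (b := c)
      (by linarith) one_pos hc
    simp only [Real.rpow_one] at this
    exact Integrable.ofReal this
  have hinv (w : ℝ) : 𝓕⁻ f w =
      ((c : ℂ) - 2 * Real.pi * I * w) ^ (-(ν : ℂ)) * Complex.Gamma ν := by
    rw [Real.fourierInv_eq', ← integral_rpow_mul_cexp_neg_mul_Ioi (by linarith)
      (by simpa using hc), ← integral_indicator measurableSet_Ioi]
    congr 1 with t
    by_cases ht : t ∈ Set.Ioi 0
    · simp only [hf, Set.indicator_of_mem ht, smul_eq_mul]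
      push_cast
      rw [mul_left_comm, ← Complex.exp_add]
      congr 2
      simp
      ring
    · simp [hf, ht]
  have hcont : ContinuousAt f x := by
    have : f =ᶠ[nhds x] fun t ↦ ((t ^ (ν - 1) * Real.exp (-c * t) : ℝ) : ℂ) := by
      filter_upwards [Ioi_mem_nhds hx] with t ht using by simp only [hf, Set.indicator_of_mem ht]
    refine ContinuousAt.congr ?_ this.symm
    refine Complex.continuous_ofReal.continuousAt.comp ?_
    exact (Real.continuousAt_rpow_const _ _ (Or.inl hx.ne')).mul (by fun_prop)
  have hinv_int : Integrable (𝓕⁻ f) := by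
    rw [funext hinv]
    exact (integrable_cpow_neg hν hc).mul_const _
  have hfourier_int : Integrable (𝓕 f) := by
    refine hinv_int.comp_neg.congr (ae_of_all _ fun w ↦ ?_)
    simp [Real.fourierInv_eq_fourier_neg]
  have key := hfint.fourier_fourierInv_eq hfourier_int hcont
  have hΓ : Complex.Gamma ν ≠ 0 := Complex.Gamma_ne_zero_of_re_pos (by simp; linarith)
  rw [eq_div_iff hΓ, ← integral_mul_const]
  rw [Real.fourier_eq', hf, Set.indicator_of_mem (Set.mem_Ioi.2 hx)] at key
  simp only [← hf, hinv] at key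
  convert key using 1
  · congr 1 with t
    rw [smul_eq_mul, mul_right_comm, mul_comm]
    congr 2
    simp
    ring
  · push_cast [Complex.ofReal_cpow hx.le]
    rw [mul_comm]
    congr 2
    ring

lemma norm_truncated_integral_sub_le {ν c x : ℝ} (hν : 1 < ν) (hc : 0 < c) (hx : 0 < x) :
    ‖(∫ α in (-(1 : ℝ) / 2)..(1 / 2),
        ((c : ℂ) - 2 * Real.pi * I * α) ^ (-(ν : ℂ)) * cexp (-(2 * Real.pi * I * x * α))) -
      cexp (-(x * c)) * (x : ℂ) ^ ((ν : ℂ) - 1) / Complex.Gamma ν‖ ≤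
    ∫ α : ℝ, (1 + ‖α‖) ^ (-ν) := by
  have hexp (α : ℝ) : ‖cexp (-(2 * Real.pi * I * x * α))‖ = 1 := by
    simp [Complex.norm_exp]
  have hK : Integrable fun α : ℝ ↦ (1 + ‖α‖) ^ (-ν) :=
    integrable_one_add_norm (by simpa using hν)
  have hint : Integrable fun α : ℝ ↦
      ((c : ℂ) - 2 * Real.pi * I * α) ^ (-(ν : ℂ)) * cexp (-(2 * Real.pi * I * x * α)) :=
    (integrable_cpow_neg hν hc).mul_bdd (Continuous.aestronglyMeasurable (by fun_prop))
      (ae_of_all _ fun α ↦ (hexp α).le)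
  rw [← integral_cpow_neg_mul_cexp hν hc hx, intervalIntegral.integral_of_le (by norm_num),
    norm_sub_rev, ← setIntegral_compl measurableSet_Ioc hint]
  refine (norm_integral_le_of_norm_le hK.integrableOn ?_).trans
    (setIntegral_le_integral hK (ae_of_all _ fun α ↦ by positivity))
  refine (ae_restrict_iff' measurableSet_Ioc.compl).2 (ae_of_all _ fun α hα ↦ ?_)
  rw [norm_mul, hexp, mul_one, ← ofReal_neg, norm_cpow_real]
  refine Real.rpow_le_rpow_of_nonpos (by positivity) (one_add_abs_le_norm ?_) (by linarith)
  rw [Set.mem_compl_iff, Set.mem_Ioc, not_and_or, not_lt, not_le] at hα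
  rcases hα with h | h
  · exact le_abs.2 (Or.inr (by linarith))
  · exact le_abs.2 (Or.inl h.le)

lemma integral_cpow_neg_mul_cexp_by_parts {μ c x : ℝ} (hc : 0 < c) (hx : 0 < x) (a b : ℝ) :
    ∫ α in a..b, ((c : ℂ) - 2 * Real.pi * I * α) ^ (-(μ : ℂ)) *
        cexp (-(2 * Real.pi * I * x * α)) =
      (((c : ℂ) - 2 * Real.pi * I * b) ^ (-(μ : ℂ)) *
          (cexp (-(2 * Real.pi * I * x * b)) / (-(2 * Real.pi * I * x))) -
        ((c : ℂ) - 2 * Real.pi * I * a) ^ (-(μ : ℂ)) *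
          (cexp (-(2 * Real.pi * I * x * a)) / (-(2 * Real.pi * I * x)))) +
      μ / x * ∫ α in a..b, ((c : ℂ) - 2 * Real.pi * I * α) ^ (-((μ + 1 : ℝ) : ℂ)) *
        cexp (-(2 * Real.pi * I * x * α)) := by
  have hne : (2 * Real.pi * I * x : ℂ) ≠ 0 := by simp [hx.ne']
  have hx' : (x : ℂ) ≠ 0 := by simp [hx.ne']
  have hu (α : ℝ) : HasDerivAt (fun α : ℝ ↦ ((c : ℂ) - 2 * Real.pi * I * α) ^ (-(μ : ℂ)))
      (2 * Real.pi * I * μ * ((c : ℂ) - 2 * Real.pi * I * α) ^ (-((μ + 1 : ℝ) : ℂ))) α := by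
    have h : HasDerivAt (fun w : ℂ ↦ (c : ℂ) - 2 * Real.pi * I * w) (-(2 * Real.pi * I)) α := by
      simpa using ((hasDerivAt_id (α : ℂ)).const_mul (2 * Real.pi * I : ℂ)).const_sub (c : ℂ)
    convert (h.cpow_const (c := -(μ : ℂ)) (sub_mem_slitPlane hc α)).comp_ofReal using 1
    rw [show -((μ + 1 : ℝ) : ℂ) = -(μ : ℂ) - 1 by push_cast; ring]
    ring
  have hv (α : ℝ) : HasDerivAt
      (fun α : ℝ ↦ cexp (-(2 * Real.pi * I * x * α)) / (-(2 * Real.pi * I * x)))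
      (cexp (-(2 * Real.pi * I * x * α))) α := by
    have h : HasDerivAt (fun w : ℂ ↦ -(2 * Real.pi * I * x * w)) (-(2 * Real.pi * I * x)) α := by
      simpa using ((hasDerivAt_id (α : ℂ)).const_mul (2 * Real.pi * I * x : ℂ)).fun_neg
    convert (h.cexp.div_const (-(2 * Real.pi * I * x))).comp_ofReal using 1
    rw [mul_div_cancel_right₀ _ (neg_ne_zero.2 hne)]
  rw [intervalIntegral.integral_mul_deriv_eq_deriv_mul (fun α _ ↦ hu α) (fun α _ ↦ hv α)
    (Continuous.intervalIntegrable (by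
      exact continuous_const.mul
        (Continuous.cpow (by fun_prop) continuous_const fun α ↦ sub_mem_slitPlane hc α)) _ _)
    (Continuous.intervalIntegrable (by fun_prop) _ _), sub_eq_add_neg _ (∫ _ in a..b, _),
    ← intervalIntegral.integral_neg, ← intervalIntegral.integral_const_mul]
  congr 2 with α
  field_simp

/-- For a positive integer `N` and real `μ > 0`, with `z = z(α) = 1/N − 2πiα`,
`∫_{−1/2}^{1/2} z^{−μ} e(−nα) dα = e^{−n/N} n^{μ−1}/Γ(μ) + O_μ(1/n)`, uniformly for
integers `n ≥ 1`. -/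
theorem laplace_main_term_formula (μ : ℝ) (hμ : 0 < μ) :
    ∃ C > (0 : ℝ), ∀ N : ℕ, 1 ≤ N → ∀ n : ℕ, 1 ≤ n →
      ‖(∫ α in (-(1 : ℝ) / 2)..(1 / 2),
            ((1 : ℂ) / N - 2 * Real.pi * Complex.I * α) ^ (-(μ : ℂ)) *
              Complex.exp (-(2 * Real.pi * Complex.I * n * α))) -
          Complex.exp (-(n : ℂ) / N) * (n : ℂ) ^ ((μ : ℂ) - 1) / Complex.Gamma (μ : ℂ)‖ ≤
        C / n := by
  set K : ℝ := ∫ α : ℝ, (1 + ‖α‖) ^ (-(μ + 1)) with hK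
  have hK0 : 0 ≤ K := integral_nonneg fun α ↦ by positivity
  refine ⟨1 + μ * K, by positivity, fun N hN n hn ↦ ?_⟩
  have hc : (0 : ℝ) < 1 / N := by positivity
  have hx : (0 : ℝ) < n := by positivity
  have hn0 : (n : ℂ) ≠ 0 := by exact_mod_cast hx.ne'
  have hμ0 : (μ : ℂ) ≠ 0 := by exact_mod_cast hμ.ne'
  have hparts := integral_cpow_neg_mul_cexp_by_parts (μ := μ) hc hx (-1 / 2) (1 / 2)
  have htail := norm_truncated_integral_sub_le (ν := μ + 1) (by linarith) hc hx
  rw [← hK] at htail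
  have hmain : cexp (-(n : ℂ) / N) * (n : ℂ) ^ ((μ : ℂ) - 1) / Complex.Gamma μ =
      μ / n * (cexp (-(n * (1 / N))) * (n : ℂ) ^ ((μ : ℂ) + 1 - 1) / Complex.Gamma (μ + 1)) := by
    rw [Complex.Gamma_add_one _ hμ0, add_sub_cancel_right, Complex.cpow_sub _ _ hn0, cpow_one,
      neg_div, mul_one_div]
    field_simp
  have hbdry (b : ℝ) (hb : 1 / 2 ≤ |b|) :
      ‖(((1 / N : ℝ) : ℂ) - 2 * Real.pi * I * b) ^ (-(μ : ℂ)) *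
        (cexp (-(2 * Real.pi * I * (n : ℝ) * b)) / (-(2 * Real.pi * I * (n : ℝ))))‖ ≤
      1 / 2 / n := by
    rw [norm_mul, norm_div, ← ofReal_neg, norm_cpow_real]
    have h1 : ‖((1 / N : ℝ) : ℂ) - 2 * Real.pi * I * b‖ ^ (-μ) ≤ 1 :=
      Real.rpow_le_one_of_one_le_of_nonpos
        (by linarith [one_add_abs_le_norm (c := 1 / N) hb, abs_nonneg b]) (by linarith)
    have h2 : ‖cexp (-(2 * Real.pi * I * (n : ℝ) * b))‖ = 1 := by simp [Complex.norm_exp]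
    have h3 : ‖-(2 * Real.pi * I * (n : ℝ) : ℂ)‖ = 2 * Real.pi * n := by
      simp [abs_of_pos Real.pi_pos]
    rw [h2, h3, div_div]
    refine mul_le_of_le_one_left (by positivity) h1 |>.trans ?_
    gcongr
    linarith [Real.pi_gt_three]
  have hb1 := hbdry (1 / 2) (le_abs_self _)
  have hb2 := hbdry (-1 / 2) (le_abs.2 (Or.inr (by norm_num)))
  rw [hmain]
  push_cast at hparts htail hb1 hb2
  rw [hparts, add_sub_assoc, ← mul_sub]
  have h4 : ‖(μ / n : ℂ)‖ = μ / n := by simp [abs_of_pos hμ]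
  refine (norm_add_le _ _).trans ?_
  rw [norm_mul, h4]
  have h5 := mul_le_mul_of_nonneg_left htail (show 0 ≤ μ / n by positivity)
  have h6 := (norm_sub_le _ _).trans (add_le_add hb1 hb2)
  refine (add_le_add h6 h5).trans (le_of_eq ?_)
  ring
end
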